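/- Assume q^N = (-1)^{N+1} and q^2 is a primitive N-th root of unity. Let V₁, V₂, V₁′, V₂′ be finite-dimensional complex vector spaces, each equipped with a Weyl pair, and let L : V₁ ⊗ V₂ → V₁′ ⊗ V₂′ be a linear map. Then the following are equivalent. (1) There exist a regular pair (μ, ν) of standard Weyl pairs (with its product μν and Clebsch–Gordan space V_{(μ,ν)} carrying the Weyl pair X̂f = P^{-1}∘f, Ŷf = Q∘f, where P = X_μ^{-1}⊗Id + Y_μ⊗Y_ν^{-1} and Q = q^{-1}·Y_μ⊗X_ν^{-1}Y_ν^{-1}), linear isomorphisms φ₁ : V₁ → V_{(μ,ν)}, φ₂ : V₂ → ℂ^N, φ₁′ : V₁′ → ℂ^N, φ₂′ : V₂′ → ℂ^N each intertwining the given Weyl pair on its source with, respectively, (X̂, Ŷ), the Weyl pair μν, the Weyl pair μ, and the Weyl pair ν, and a nonzero scalar c ∈ ℂ, such that (φ₁′⊗φ₂′)∘L = c·Ω(μ,ν)∘(φ₁⊗φ₂), where Ω(μ,ν) : V_{(μ,ν)}⊗ℂ^N → ℂ^N⊗ℂ^N is the canonical map f⊗w ↦ f(w). (2) There exist a regular triple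 (μ, ν, σ) of standard Weyl pairs, linear isomorphisms φ₁ : V₁ → V_{(μ,ν)}, φ₂ : V₂ → V_{(μν,σ)}, φ₁′ : V₁′ → V_{(μ,νσ)}, φ₂′ : V₂′ → V_{(ν,σ)} each intertwining the given Weyl pair with the Weyl pair (X̂, Ŷ) on the corresponding Clebsch–Gordan space (defined by the same formulas from the relevant pair of factors), and a nonzero scalar c ∈ ℂ, such that (φ₁′⊗φ₂′)∘L = c·R(μ,ν,σ)∘(φ₁⊗φ₂), where R(μ,ν,σ) : V_{(μ,ν)}⊗V_{(μν,σ)} → V_{(μ,νσ)}⊗V_{(ν,σ)} is the unique linear map (Kashaev's 6j-symbol) satisfying: for all f ∈ V_{(μ,ν)}, g ∈ V_{(μν,σ)}, w ∈ ℂ^N, writing R(f⊗g) = Σ_i f_i⊗g_i, one has Σ_i (Id_{ℂ^N}⊗g_i)(f_i(w)) = (f⊗Id_{ℂ^N})(g(w)). -/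

import Mathlib

open TensorProduct

noncomputable section

/-- ℂ^N: functions from ℤ/Nℤ to ℂ. -/
abbrev CN (N : ℕ) := ZMod N → ℂ

/-- The operator A with A e_k = q^{2k} e_k. -/
def opA (q : ℂ) (N : ℕ) : Module.End ℂ (CN N) where
  toFun f := fun k => q ^ (2 * k.val) * f k
  map_add' f g := by funext k; simp [mul_add]
  map_smul' c f := by funext k; simp [smul_eq_mul]; ring

/-- The operator B with B e_k = e_{k+1}. -/
def opB (N : ℕ) : Module.End ℂ (CN N) where
  toFun f := fun k => f (k - 1)
  map_add' f g := by funext k; simp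
  map_smul' c f := by funext k; simp

/-- The operator C with C e_k = q^{1-2k} e_{k-1}, i.e. (C f)(k) = q^{-1-2k} f(k+1). -/
def opC (q : ℂ) (N : ℕ) : Module.End ℂ (CN N) where
  toFun f := fun k => q ^ (-1 - 2 * (k.val : ℤ)) * f (k + 1)
  map_add' f g := by funext k; simp [mul_add]
  map_smul' c f := by funext k; simp [smul_eq_mul]; ring

/-- A Weyl pair: invertible endomorphisms with X Y = q² Y X. -/
def IsWeylPair (q : ℂ) {V : Type*} [AddCommMonoid V] [Module ℂ V]
    (X Y : Module.End ℂ V) : Prop :=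
  IsUnit X ∧ IsUnit Y ∧ X * Y = q ^ 2 • (Y * X)

/-- A subspace invariant under both X and Y. -/
def WeylInvariant {V : Type*} [AddCommMonoid V] [Module ℂ V]
    (X Y : Module.End ℂ V) (W : Submodule ℂ V) : Prop :=
  (∀ v ∈ W, X v ∈ W) ∧ (∀ v ∈ W, Y v ∈ W)

/-- An irreducible Weyl pair. -/
def IsIrreducibleWeylPair (q : ℂ) {V : Type*} [AddCommMonoid V] [Module ℂ V]
    (X Y : Module.End ℂ V) : Prop :=
  IsWeylPair q X Y ∧ Nontrivial V ∧
    ∀ W : Submodule ℂ V, WeylInvariant X Y W → W = ⊥ ∨ W = ⊤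
/-- The Clebsch–Gordan space of a pair of Weyl pairs: all linear maps
f : ℂ^N → ℂ^N ⊗ ℂ^N with f∘X_{αβ} = (X_α⊗X_β)∘f and
f∘Y_{αβ} = (X_α⁻¹⊗Y_β + Y_α⊗Id)∘f. -/
def CGsub (N : ℕ) (Xa Ya Xb Yb Xab Yab : Module.End ℂ (CN N)) :
    Submodule ℂ (CN N →ₗ[ℂ] (CN N ⊗[ℂ] CN N)) where
  carrier := {f | f ∘ₗ Xab = (TensorProduct.map Xa Xb) ∘ₗ f ∧
    f ∘ₗ Yab = (TensorProduct.map (Ring.inverse Xa) Yb + TensorProduct.map Ya 1) ∘ₗ f}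
  add_mem' := by
    rintro f g ⟨hf1, hf2⟩ ⟨hg1, hg2⟩
    constructor <;> simp only [LinearMap.add_comp, LinearMap.comp_add, hf1, hf2, hg1, hg2]
  zero_mem' := by constructor <;> simp
  smul_mem' := by
    rintro c f ⟨hf1, hf2⟩
    constructor <;> simp only [LinearMap.smul_comp, LinearMap.comp_smul, hf1, hf2]

/-- The space of linear maps ℂ^N → ℂ^N ⊗ ℂ^N ⊗ ℂ^N intertwining the Weyl pair
(Xp, Yp) with the triple tensor operators of (Xμ,Yμ), (Xν,Yν), (Xσ,Yσ). -/
def CG3sub (N : ℕ) (Xμ Yμ Xν Yν Xσ Yσ Xp Yp : Module.End ℂ (CN N)) :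
    Submodule ℂ (CN N →ₗ[ℂ] (CN N ⊗[ℂ] (CN N ⊗[ℂ] CN N))) where
  carrier := {F | F ∘ₗ Xp = (TensorProduct.map Xμ (TensorProduct.map Xν Xσ)) ∘ₗ F ∧
    F ∘ₗ Yp = (TensorProduct.map (Ring.inverse Xμ) (TensorProduct.map (Ring.inverse Xν) Yσ)
      + TensorProduct.map (Ring.inverse Xμ) (TensorProduct.map Yν 1)
      + TensorProduct.map Yμ 1) ∘ₗ F}
  add_mem' := by
    rintro f g ⟨hf1, hf2⟩ ⟨hg1, hg2⟩
    constructor <;> simp only [LinearMap.add_comp, LinearMap.comp_add, hf1, hf2, hg1, hg2]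
  zero_mem' := by constructor <;> simp
  smul_mem' := by
    rintro c f ⟨hf1, hf2⟩
    constructor <;> simp only [LinearMap.smul_comp, LinearMap.comp_smul, hf1, hf2]

/-- The bilinear map (f, g) ↦ assoc ∘ (f ⊗ Id) ∘ g, f ⊗ g acting as
w ↦ (f ⊗ Id_{ℂ^N})(g(w)) ∈ ℂ^N ⊗ ℂ^N ⊗ ℂ^N. -/
def phiRaw (N : ℕ) :
    (CN N →ₗ[ℂ] CN N ⊗[ℂ] CN N) →ₗ[ℂ] (CN N →ₗ[ℂ] CN N ⊗[ℂ] CN N) →ₗ[ℂ]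
      (CN N →ₗ[ℂ] CN N ⊗[ℂ] (CN N ⊗[ℂ] CN N)) :=
  LinearMap.mk₂ ℂ
    (fun f g => (TensorProduct.assoc ℂ (CN N) (CN N) (CN N)).toLinearMap ∘ₗ
      (TensorProduct.map f LinearMap.id) ∘ₗ g)
    (fun f f' g => by
      simp only [TensorProduct.map_add_left, LinearMap.add_comp, LinearMap.comp_add])
    (fun c f g => by
      simp only [TensorProduct.map_smul_left, LinearMap.smul_comp, LinearMap.comp_smul])
    (fun f g g' => by
      simp only [LinearMap.comp_add])
    (fun c f g => by
      simp only [LinearMap.comp_smul])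

/-- The bilinear map (f, g) ↦ (Id ⊗ g) ∘ f, f ⊗ g acting as
w ↦ (Id_{ℂ^N} ⊗ g)(f(w)) ∈ ℂ^N ⊗ ℂ^N ⊗ ℂ^N. -/
def psiRaw (N : ℕ) :
    (CN N →ₗ[ℂ] CN N ⊗[ℂ] CN N) →ₗ[ℂ] (CN N →ₗ[ℂ] CN N ⊗[ℂ] CN N) →ₗ[ℂ]
      (CN N →ₗ[ℂ] CN N ⊗[ℂ] (CN N ⊗[ℂ] CN N)) :=
  LinearMap.mk₂ ℂ
    (fun f g => (TensorProduct.map LinearMap.id g) ∘ₗ f)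
    (fun f f' g => by simp only [LinearMap.comp_add])
    (fun c f g => by simp only [LinearMap.comp_smul])
    (fun f g g' => by
      simp only [TensorProduct.map_add_right, LinearMap.add_comp])
    (fun c f g => by
      simp only [TensorProduct.map_smul_right, LinearMap.smul_comp])

/-- The linear map V_{(μ,ν)} ⊗ V_{(μν,σ)} → Hom(ℂ^N, ℂ^N⊗ℂ^N⊗ℂ^N),
f ⊗ g ↦ (f⊗Id)∘g. -/
def phiL (N : ℕ) (CG1 CG2 : Submodule ℂ (CN N →ₗ[ℂ] CN N ⊗[ℂ] CN N)) :
    (CG1 ⊗[ℂ] CG2) →ₗ[ℂ] (CN N →ₗ[ℂ] CN N ⊗[ℂ] (CN N ⊗[ℂ] CN N)) :=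
  TensorProduct.lift (((phiRaw N).comp CG1.subtype).compl₂ CG2.subtype)

/-- The linear map V_{(μ,νσ)} ⊗ V_{(ν,σ)} → Hom(ℂ^N, ℂ^N⊗ℂ^N⊗ℂ^N),
f ⊗ g ↦ (Id⊗g)∘f. -/
def psiL (N : ℕ) (CG1 CG2 : Submodule ℂ (CN N →ₗ[ℂ] CN N ⊗[ℂ] CN N)) :
    (CG1 ⊗[ℂ] CG2) →ₗ[ℂ] (CN N →ₗ[ℂ] CN N ⊗[ℂ] (CN N ⊗[ℂ] CN N)) :=
  TensorProduct.lift (((psiRaw N).comp CG1.subtype).compl₂ CG2.subtype)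

/-- The operator P = X_α⁻¹⊗Id + Y_α⊗Y_β⁻¹ on ℂ^N ⊗ ℂ^N. -/
def Pop (N : ℕ) (Xa Ya Yb : Module.End ℂ (CN N)) : Module.End ℂ (CN N ⊗[ℂ] CN N) :=
  TensorProduct.map (Ring.inverse Xa) 1 + TensorProduct.map Ya (Ring.inverse Yb)

/-- The operator Q = q⁻¹·Y_α⊗X_β⁻¹Y_β⁻¹ on ℂ^N ⊗ ℂ^N. -/
def Qop (N : ℕ) (q : ℂ) (Ya Xb Yb : Module.End ℂ (CN N)) :
    Module.End ℂ (CN N ⊗[ℂ] CN N) :=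
  q⁻¹ • TensorProduct.map Ya (Ring.inverse Xb * Ring.inverse Yb)

/-- φ intertwines the Weyl pair (XV, YV) on V with a standard Weyl pair on ℂ^N. -/
def IntertwinesStd {V : Type*} [AddCommMonoid V] [Module ℂ V] (N : ℕ)
    (Xs Ys : Module.End ℂ (CN N)) (XV YV : Module.End ℂ V) (φ : V ≃ₗ[ℂ] CN N) : Prop :=
  ∀ w : V, φ (XV w) = Xs (φ w) ∧ φ (YV w) = Ys (φ w)

/-- φ intertwines the Weyl pair (XV, YV) on V with the Weyl pair
(X̂ : f ↦ P⁻¹∘f, Ŷ : f ↦ Q∘f) on the Clebsch–Gordan space V_{(α,β)}. -/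
def IntertwinesCG {V : Type*} [AddCommMonoid V] [Module ℂ V] (N : ℕ) (q : ℂ)
    (Xa Ya Xb Yb Xab Yab : Module.End ℂ (CN N)) (XV YV : Module.End ℂ V)
    (φ : V ≃ₗ[ℂ] ↥(CGsub N Xa Ya Xb Yb Xab Yab)) : Prop :=
  ∀ w : V,
    ((φ (XV w) : CN N →ₗ[ℂ] CN N ⊗[ℂ] CN N) =
      Ring.inverse (Pop N Xa Ya Yb) ∘ₗ (φ w : CN N →ₗ[ℂ] CN N ⊗[ℂ] CN N)) ∧
    ((φ (YV w) : CN N →ₗ[ℂ] CN N ⊗[ℂ] CN N) =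
      Qop N q Ya Xb Yb ∘ₗ (φ w : CN N →ₗ[ℂ] CN N ⊗[ℂ] CN N))

section ring
variable {A : Type*} [Ring A] [Algebra ℂ A]

structure W2 (q : ℂ) (x1 y1 x2 y2 : A) : Prop where
  ux1 : IsUnit x1
  uy1 : IsUnit y1
  ux2 : IsUnit x2
  uy2 : IsUnit y2
  w1 : x1 * y1 = q ^ 2 • (y1 * x1)
  w2 : x2 * y2 = q ^ 2 • (y2 * x2)
  cxx : x1 * x2 = x2 * x1
  cxy : x1 * y2 = y2 * x1
  cyx : y1 * x2 = x2 * y1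
  cyy : y1 * y2 = y2 * y1

structure TRel (q : ℂ) (x1 y1 x2 y2 a b c d : A) : Prop where
  r1 : x2 = a * c
  r2 : x1 * y2 = d
  r3 : a = x1 + q⁻¹ • (x1 * y1 * x2)
  r4 : a * b = q⁻¹ • (x1 * y1 * x2 * y2)

theorem W2.map {B : Type*} [Ring B] [Algebra ℂ B] (φ : A →ₐ[ℂ] B) {q : ℂ} {x1 y1 x2 y2 : A}
    (h : W2 q x1 y1 x2 y2) : W2 q (φ x1) (φ y1) (φ x2) (φ y2) where
  ux1 := h.ux1.map φ
  uy1 := h.uy1.map φ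
  ux2 := h.ux2.map φ
  uy2 := h.uy2.map φ
  w1 := by simpa using congrArg φ h.w1
  w2 := by simpa using congrArg φ h.w2
  cxx := by simpa using congrArg φ h.cxx
  cxy := by simpa using congrArg φ h.cxy
  cyx := by simpa using congrArg φ h.cyx
  cyy := by simpa using congrArg φ h.cyy

theorem TRel.map {B : Type*} [Ring B] [Algebra ℂ B] (φ : A →ₐ[ℂ] B) {q : ℂ}
    {x1 y1 x2 y2 a b c d : A}
    (h : TRel q x1 y1 x2 y2 a b c d) :
    TRel q (φ x1) (φ y1) (φ x2) (φ y2) (φ a) (φ b) (φ c) (φ d) where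
  r1 := by simpa using congrArg φ h.r1
  r2 := by simpa using congrArg φ h.r2
  r3 := by simpa using congrArg φ h.r3
  r4 := by simpa using congrArg φ h.r4

theorem TRel.of_map {B : Type*} [Ring B] [Algebra ℂ B] (φ : A →ₐ[ℂ] B) (hφ : Function.Injective φ)
    {q : ℂ} {x1 y1 x2 y2 a b c d : A}
    (h : TRel q (φ x1) (φ y1) (φ x2) (φ y2) (φ a) (φ b) (φ c) (φ d)) :
    TRel q x1 y1 x2 y2 a b c d where
  r1 := hφ (by simpa using h.r1)
  r2 := hφ (by simpa using h.r2)
  r3 := hφ (by simpa using h.r3)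
  r4 := hφ (by simpa using h.r4)

theorem TRel.key {q : ℂ} (hq : q ≠ 0) {x1 y1 x2 y2 a b c d : A} (w : W2 q x1 y1 x2 y2)
    (h : TRel q x1 y1 x2 y2 a b c d) : a * y2 = d + a * b := by
  rw [h.r4, ← h.r2]
  conv_lhs => rw [h.r3]
  rw [add_mul, smul_mul_assoc]

theorem TRel.uniq {q : ℂ} (hq : q ≠ 0) {x1 y1 x2 y2 X1 Y1 X2 Y2 a b c d : A}
    (w : W2 q x1 y1 x2 y2) (W : W2 q X1 Y1 X2 Y2) (ha : IsUnit a)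
    (h : TRel q x1 y1 x2 y2 a b c d) (H : TRel q X1 Y1 X2 Y2 a b c d) :
    x1 = X1 ∧ y1 = Y1 ∧ x2 = X2 ∧ y2 = Y2 := by
  have e2 : x2 = X2 := h.r1.trans H.r1.symm
  have e3 : y2 = Y2 := ha.mul_left_cancel ((h.key hq w).trans (H.key hq W).symm)
  subst e2 e3
  have e1 : x1 = X1 := w.uy2.mul_right_cancel (h.r2.trans H.r2.symm)
  subst e1
  refine ⟨rfl, ?_, rfl, rfl⟩
  have := h.r4.symm.trans H.r4
  have h2 := smul_right_injective A (inv_ne_zero hq) this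
  exact w.ux1.mul_left_cancel (w.ux2.mul_right_cancel (w.uy2.mul_right_cancel h2))

theorem W2.a_y2 {q : ℂ} (hq : q ≠ 0) {x1 y1 x2 y2 a b c d : A} (w : W2 q a b c d)
    (uy2 : IsUnit y2) (e1 : x2 = a * c) (e2 : a * y2 = d + a * b) (e3 : x1 * y2 = d)
    (e4 : q • (y1 * d * c) = b) :
    W2 q x1 y1 x2 y2 ∧ TRel q x1 y1 x2 y2 a b c d := by
  have q2 : q ^ 2 ≠ 0 := pow_ne_zero _ hq
  have w1' : b * a = (q ^ 2)⁻¹ • (a * b) := by rw [w.w1, smul_smul, inv_mul_cancel₀ q2, one_smul]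
  have w2' : d * c = (q ^ 2)⁻¹ • (c * d) := by rw [w.w2, smul_smul, inv_mul_cancel₀ q2, one_smul]
  have ux2 : IsUnit x2 := e1 ▸ w.ux1.mul w.ux2
  -- Weyl for x2,y2
  have i : x2 * y2 = q ^ 2 • (y2 * x2) := by
    apply w.ux1.mul_left_cancel
    calc a * (x2 * y2) = a * c * (a * y2) := by
            rw [e1]; simp only [mul_assoc]; rw [← mul_assoc c a, ← w.cxx, mul_assoc]
      _ = q ^ 2 • ((a * y2) * x2) := by
            rw [e2, e1, mul_add, add_mul, smul_add]
            congr 1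
            · rw [mul_assoc, w.w2, mul_smul_comm, ← mul_assoc, w.cxy, mul_assoc]
            · calc a * c * (a * b) = a * (c * a) * b := by simp only [mul_assoc]
                _ = a * a * (c * b) := by rw [← w.cxx]; simp only [mul_assoc]
                _ = a * (a * b) * c := by rw [← w.cyx]; simp only [mul_assoc]
                _ = a * (q ^ 2 • (b * a)) * c := by rw [← w.w1]
                _ = _ := by simp only [mul_assoc, mul_smul_comm, smul_mul_assoc]
      _ = _ := by simp only [mul_assoc, mul_smul_comm]
  have ii : x1 * x2 = x2 * x1 := by
    apply uy2.mul_right_cancel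
    calc x1 * x2 * y2 = q ^ 2 • (x1 * y2 * x2) := by
            rw [mul_assoc, i, mul_smul_comm, mul_assoc]
      _ = a * (q ^ 2 • (d * c)) := by rw [e3, e1, ← mul_assoc, ← w.cxy, mul_smul_comm, mul_assoc]
      _ = x2 * x1 * y2 := by rw [← w.w2, mul_assoc x2, e3, e1, mul_assoc]
  have dy : d * y2 = y2 * d := by
    apply w.ux1.mul_left_cancel
    rw [← mul_assoc, w.cxy, mul_assoc, e2, ← mul_assoc, e2, mul_add, add_mul, ← mul_assoc,
      ← w.cxy, mul_assoc, ← w.cyy, mul_assoc]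
  have iii : x1 * y2 = y2 * x1 := by
    apply uy2.mul_right_cancel
    rw [mul_assoc y2, e3, dy]
  have e4' : y1 * d * c = q⁻¹ • b := by rw [← e4, smul_smul, inv_mul_cancel₀ hq, one_smul]
  have iv : y1 * x2 = x2 * y1 := by
    apply (w.uy2.mul w.ux2).mul_right_cancel
    calc y1 * x2 * (d * c) = y1 * (a * (c * d) * c) := by rw [e1]; simp only [mul_assoc]
      _ = q ^ 2 • (y1 * (a * d * c * c)) := by
          rw [w.w2]; simp only [mul_assoc, mul_smul_comm, smul_mul_assoc]
      _ = q ^ 2 • (y1 * d * (a * c) * c) := by rw [w.cxy]; simp only [mul_assoc]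
      _ = q ^ 2 • ((y1 * d * c) * (a * c)) := by rw [w.cxx]; simp only [mul_assoc, w.cxx]
      _ = q⁻¹ • ((q ^ 2 • (b * a)) * c) := by
          rw [e4']; simp only [mul_assoc, smul_mul_assoc]; rw [smul_comm]
      _ = q⁻¹ • (a * c * b) := by rw [← w.w1, mul_assoc, w.cyx, mul_assoc]
      _ = x2 * (y1 * d * c) := by rw [e4', e1, mul_smul_comm]
      _ = _ := by simp only [mul_assoc]
  have uy1 : IsUnit y1 := by
    have : IsUnit (y1 * (d * c)) := by
      rw [← mul_assoc, e4']
      exact ((isUnit_iff_ne_zero.2 (inv_ne_zero hq)).map (algebraMap ℂ A)).mul w.uy1 |> fun h => by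
        rwa [← Algebra.smul_def] at h
    obtain ⟨z, hz⟩ := w.uy2.mul w.ux2
    rw [← hz] at this
    simpa using this
  have ux1 : IsUnit x1 := by
    have : IsUnit (x1 * y2) := e3 ▸ w.uy2
    obtain ⟨z, hz⟩ := uy2
    rw [← hz] at this
    simpa using this
  have yba : y2 * (b * a) = (q ^ 2)⁻¹ • (b * a * y2) := by
    apply w.ux1.mul_left_cancel
    calc a * (y2 * (b * a)) = (a * y2) * (b * a) := by simp only [mul_assoc]
      _ = b * a * d + a * b * (b * a) := by
        rw [e2, add_mul]; congr 1
        rw [← mul_assoc, ← w.cyy, mul_assoc, ← w.cxy, mul_assoc]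
      _ = (q ^ 2)⁻¹ • (a * b * d + a * b * (a * b)) := by
        rw [w1']; simp only [smul_mul_assoc, mul_smul_comm, smul_add]
      _ = (q ^ 2)⁻¹ • (a * b * (a * y2)) := by rw [e2, mul_add]
      _ = _ := by simp only [mul_smul_comm, mul_assoc]
  have v : y1 * y2 = y2 * y1 := by
    apply (w.uy2.mul ux2).mul_right_cancel
    have hb : y1 * (d * x2) = q⁻¹ • (b * a) := by
      rw [e1, w.cxx, ← mul_assoc, ← mul_assoc, e4', smul_mul_assoc]
    have i' : y2 * x2 = (q ^ 2)⁻¹ • (x2 * y2) := by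
      rw [i, smul_smul, inv_mul_cancel₀ q2, one_smul]
    calc y1 * y2 * (d * x2) = y1 * (d * (y2 * x2)) := by
            simp only [mul_assoc]; rw [← mul_assoc y2, ← dy, mul_assoc]
      _ = (q ^ 2)⁻¹ • ((y1 * (d * x2)) * y2) := by
            rw [i']; simp only [mul_assoc, mul_smul_comm]
      _ = y2 * (y1 * (d * x2)) := by
            rw [hb, mul_smul_comm, yba, smul_mul_assoc, smul_comm]
      _ = _ := by simp only [mul_assoc]
  have dy1 : d * y1 = q ^ 2 • (y1 * d) := by
    apply (w.uy2.mul w.ux2).mul_right_cancel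
    calc d * y1 * (d * c) = d * (y1 * d * c) := by simp only [mul_assoc]
      _ = q⁻¹ • (b * d) := by rw [e4', mul_smul_comm, w.cyy]
      _ = (y1 * d * c) * d := by rw [e4', smul_mul_assoc]
      _ = y1 * d * (c * d) := by simp only [mul_assoc]
      _ = _ := by rw [w.w2]; simp only [mul_assoc, mul_smul_comm, smul_mul_assoc]
  have vi : x1 * y1 = q ^ 2 • (y1 * x1) := by
    apply uy2.mul_right_cancel
    rw [mul_assoc, v, ← mul_assoc, e3, dy1, smul_mul_assoc, mul_assoc, e3]
  have r4 : a * b = q⁻¹ • (x1 * y1 * x2 * y2) := by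
    symm
    calc q⁻¹ • (x1 * y1 * x2 * y2) = q⁻¹ • (x1 * y1 * (x2 * y2)) := by simp only [mul_assoc]
      _ = (q⁻¹ * q ^ 2) • (x1 * (y1 * y2) * x2) := by
          rw [i, mul_smul_comm, smul_smul]; simp only [mul_assoc]
      _ = (q⁻¹ * q ^ 2) • (d * y1 * x2) := by rw [v, ← mul_assoc, e3]
      _ = (q⁻¹ * q ^ 2 * q ^ 2) • (y1 * d * c * a) := by
          rw [dy1, smul_mul_assoc, smul_smul, e1, w.cxx]; simp only [mul_assoc]
      _ = q ^ 2 • (b * a) := by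
          rw [e4', smul_mul_assoc, smul_smul]; congr 1; field_simp
      _ = a * b := w.w1.symm
  refine ⟨⟨ux1, uy1, ux2, uy2, vi, i, ii, iii, iv, v⟩, e1, e3, ?_, r4⟩
  apply uy2.mul_right_cancel
  rw [e2, add_mul, e3, r4, smul_mul_assoc]

theorem sixj_ring {q : ℂ} (hq : q ≠ 0)
    {x1 y1 x2 y2 x3 y3 x1' y1' x2' y2' m n s t a b c d e f : A}
    (R1 : TRel q x2 y2 x3 y3 m n e f) (R2 : TRel q x1 y1 m n a b c d)
    (R3 : TRel q x1' y1' x3 y3 a b s t) (R4 : TRel q x2' y2' s t c d e f)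
    (u2 : IsUnit x2) (u3 : IsUnit x3) (v3 : IsUnit y3)
    (c12 : x1 * x2 = x2 * x1) (c1m : x1 * m = m * x1) (c12' : x1' * x2' = x2' * x1')
    (c12y' : x1' * y2' = y2' * x1') (c13 : x1' * x3 = x3 * x1')
    (ca : a * x2' = x2' * a) (cay : a * y2' = y2' * a) :
    TRel q x1 y1 x2 y2 x1' y1' x2' y2' := by
  have r1 : x2 = x1' * x2' := by
    apply v3.mul_right_cancel
    rw [R1.r2, ← R4.r2, ← R3.r2, c12', mul_assoc]
  have r4 : x1' * y1' = q⁻¹ • (x1 * y1 * x2 * y2) := by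
    apply u3.mul_right_cancel
    apply v3.mul_right_cancel
    apply smul_right_injective A (inv_ne_zero hq)
    show q⁻¹ • (x1' * y1' * x3 * y3) = q⁻¹ • (q⁻¹ • (x1 * y1 * x2 * y2) * x3 * y3)
    rw [← R3.r4, R2.r4, mul_assoc (x1 * y1), R1.r4]
    simp only [mul_smul_comm, smul_mul_assoc, mul_assoc]
  refine ⟨r1, ?_, ?_, r4⟩
  · apply u2.mul_left_cancel
    rw [← mul_assoc, ← c12]
    have k : x1 * x2 * y2 = x2' * y2' * x1' := by
      apply u3.mul_right_cancel
      apply v3.mul_right_cancel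
      apply smul_right_injective A (inv_ne_zero hq)
      show q⁻¹ • (x1 * x2 * y2 * x3 * y3) = q⁻¹ • (x2' * y2' * x1' * x3 * y3)
      calc q⁻¹ • (x1 * x2 * y2 * x3 * y3) = x1 * (m * n) := by
            rw [R1.r4]; simp only [mul_smul_comm, mul_assoc]
        _ = a * (c * d) := by rw [← mul_assoc, c1m, mul_assoc, R2.r2, R2.r1, mul_assoc]
        _ = q⁻¹ • (x2' * y2' * (a * s) * t) := by
            rw [R4.r4]; simp only [mul_smul_comm, ← mul_assoc]; rw [ca, mul_assoc x2', cay]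
            simp only [mul_assoc]
        _ = _ := by
            rw [← R3.r1, ← R3.r2, mul_assoc (x2' * y2') x1', c13]; simp only [mul_assoc]
    rw [k, mul_assoc, ← c12y', ← mul_assoc, ← c12', r1]
  · have h := R3.r3.symm.trans R2.r3
    rw [R1.r3, mul_add, smul_add, ← add_assoc, r4] at h
    have : q⁻¹ • (q⁻¹ • (x1 * y1 * x2 * y2) * x3) = q⁻¹ • (x1 * y1 * q⁻¹ • (x2 * y2 * x3)) := by
      simp only [mul_smul_comm, smul_mul_assoc, mul_assoc]
    rw [this] at h
    exact add_right_cancel h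

end ring

def qb (w : ℂ) : ℕ → ℕ → ℂ
  | 0, 0 => 1
  | 0, _ + 1 => 0
  | n + 1, 0 => qb w n 0
  | n + 1, k + 1 => w ^ (k + 1) * qb w n (k + 1) + qb w n k

theorem qb_zero (w : ℂ) (n : ℕ) : qb w n 0 = 1 := by
  induction n with
  | zero => rfl
  | succ n ih => rw [qb, ih]

theorem qb_gt (w : ℂ) (n : ℕ) : ∀ k, n < k → qb w n k = 0 := by
  induction n with
  | zero => intro k hk; cases k with
    | zero => omega
    | succ k => rfl
  | succ n ih => intro k hk; cases k with
    | zero => omega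
    | succ k => rw [qb, ih _ (by omega), ih _ (by omega)]; simp

theorem qb_self (w : ℂ) (n : ℕ) : qb w n n = 1 := by
  induction n with
  | zero => rfl
  | succ n ih => rw [qb, ih, qb_gt w n _ (by omega)]; simp

theorem qb_id (w : ℂ) (n : ℕ) : ∀ k, qb w (n + 1) (k + 1) * (1 - w ^ (k + 1)) =
    (1 - w ^ (n + 1)) * qb w n k := by
  induction n with
  | zero => intro k; cases k with
    | zero => simp [qb]
    | succ k => simp [qb]
  | succ n ih => intro k; cases k with
    | zero =>
      have := ih 0
      have h4 : qb w (n + 1 + 1) (0 + 1) =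
        w ^ (0 + 1) * qb w (n + 1) (0 + 1) + qb w (n + 1) 0 := rfl
      rw [h4]
      rw [qb_zero] at *
      linear_combination w * this
    | succ k =>
      have h1 := ih k
      have h2 := ih (k + 1)
      have h3 : qb w (n + 1) (k + 1) = w ^ (k + 1) * qb w n (k + 1) + qb w n k := rfl
      have h4 : qb w (n + 1 + 1) (k + 1 + 1) =
        w ^ (k + 2) * qb w (n + 1) (k + 1 + 1) + qb w (n + 1) (k + 1) := rfl
      rw [h4]
      linear_combination w ^ (k + 2) * h2 - w * (1 - w ^ (n + 1)) * h3 + w * h1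

section ring
variable {A : Type*} [Ring A] [Algebra ℂ A]

theorem comm_pow {w : ℂ} {U V : A} (h : U * V = w • (V * U)) (k : ℕ) :
    U * V ^ k = w ^ k • (V ^ k * U) := by
  induction k with
  | zero => simp
  | succ k ih =>
    rw [pow_succ, ← mul_assoc, ih, smul_mul_assoc, mul_assoc, h, mul_smul_comm, smul_smul,
      ← mul_assoc, ← pow_succ]

theorem qb_expand {w : ℂ} {U V : A} (h : U * V = w • (V * U)) (n : ℕ) :
    (U + V) ^ n = ∑ k ∈ Finset.range (n + 1), qb w n k • (V ^ k * U ^ (n - k)) := by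
  induction n with
  | zero => simp [qb]
  | succ n ih =>
    rw [pow_succ', ih, add_mul, Finset.mul_sum, Finset.mul_sum]
    rw [Finset.sum_range_succ' _ (n + 1)]
    have e1 : ∑ k ∈ Finset.range (n + 1), U * qb w n k • (V ^ k * U ^ (n - k)) =
        ∑ k ∈ Finset.range (n + 1), (w ^ (k + 1) * qb w n (k + 1)) •
          (V ^ (k + 1) * U ^ (n + 1 - (k + 1))) + qb w n 0 • (V ^ 0 * U ^ (n + 1 - 0)) := by
      have hh : ∀ k ∈ Finset.range (n + 1), U * qb w n k • (V ^ k * U ^ (n - k)) =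
         (w ^ k * qb w n k) • (V ^ k * U ^ (n + 1 - k)) := by
        intro k hk
        have : k ≤ n := by simpa [Nat.lt_succ_iff] using hk
        rw [mul_smul_comm, ← mul_assoc, comm_pow h, smul_mul_assoc, smul_smul, mul_assoc,
          ← pow_succ', mul_comm, Nat.sub_add_comm this]
      rw [Finset.sum_congr rfl hh, Finset.sum_range_succ', Finset.sum_range_succ _ n,
        qb_gt w n (n + 1) (by omega)]
      simp
    rw [e1, add_right_comm, ← Finset.sum_add_distrib]
    congr 1
    apply Finset.sum_congr rfl
    intro k hk
    rw [mul_smul_comm, ← mul_assoc, ← pow_succ', Nat.add_sub_add_right, ← add_smul]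
    rfl

theorem qb_frob {w : ℂ} {N : ℕ} (hN : 1 ≤ N) (hw : IsPrimitiveRoot w N) {U V : A}
    (h : U * V = w • (V * U)) : (U + V) ^ N = U ^ N + V ^ N := by
  obtain ⟨n, rfl⟩ : ∃ n, N = n + 1 := ⟨N - 1, by omega⟩
  rw [qb_expand h, Finset.sum_range_succ, Finset.sum_range_succ', qb_self, qb_zero]
  rw [Finset.sum_eq_zero]
  · simp
  · intro k hk
    have hk' : k < n := by simpa using hk
    have h1 := qb_id w n k
    rw [hw.pow_eq_one, sub_self, zero_mul] at h1
    have : (1 - w ^ (k + 1)) ≠ 0 := by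
      rw [sub_ne_zero]
      exact (hw.pow_ne_one_of_pos_of_lt (by omega) (by omega)).symm
    rw [(mul_eq_zero.1 h1).resolve_right this, zero_smul]

theorem weyl_pow {q : ℂ} {x y : A} (h : x * y = q ^ 2 • (y * x)) (n : ℕ) :
    x ^ n * y ^ n = q ^ (n * (n - 1)) • (x * y) ^ n := by
  induction n with
  | zero => simp
  | succ n ih =>
    calc x ^ (n + 1) * y ^ (n + 1) = x ^ n * (x * y ^ n) * y := by
          rw [pow_succ, pow_succ]; simp only [mul_assoc]
      _ = (q ^ 2) ^ n • ((x ^ n * y ^ n) * (x * y)) := by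
          rw [comm_pow h]; simp only [mul_smul_comm, smul_mul_assoc, mul_assoc]
      _ = _ := by
          rw [ih, smul_mul_assoc, ← pow_succ, smul_smul]
          congr 1
          rw [← pow_mul, ← pow_add]
          congr 1
          cases n with
          | zero => rfl
          | succ n => simp only [Nat.add_sub_cancel]; ring

theorem weyl_pow' {q : ℂ} {N : ℕ} (hN : 1 ≤ N) (hq : q ≠ 0)
    (hqN : q ^ N = (-1 : ℂ) ^ (N + 1)) {x y : A} (h : x * y = q ^ 2 • (y * x)) :
    (q⁻¹ • (x * y)) ^ N = x ^ N * y ^ N := by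
  rw [weyl_pow h, smul_pow]
  congr 1
  have : q ^ (N * (N - 1)) * q ^ N = 1 := by
    rw [← pow_add]
    have : N * (N - 1) + N = N * N := by
      obtain ⟨n, rfl⟩ : ∃ n, N = n + 1 := ⟨N - 1, by omega⟩
      simp only [Nat.add_sub_cancel]; ring
    rw [this, pow_mul, hqN, ← pow_mul]
    apply Even.neg_one_pow
    rw [mul_comm]; exact Nat.even_mul_succ_self N
  rw [inv_pow]
  exact (eq_inv_of_mul_eq_one_left this).symm

theorem frob_y {q : ℂ} {N : ℕ} (hN : 1 ≤ N) (hp : IsPrimitiveRoot (q ^ 2) N)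
    {a b c d y2 : A} (W : W2 q a b c d) (key : a * y2 = d + a * b) :
    a ^ N * y2 ^ N = d ^ N + a ^ N * b ^ N := by
  obtain ⟨α, rfl⟩ := W.ux1
  have hy : y2 = b + ↑α⁻¹ * d := by
    rw [← Units.inv_mul_cancel_left α y2, key, mul_add, Units.inv_mul_cancel_left, add_comm]
  have hc : Commute (↑α⁻¹ : A) d := (Commute.units_inv_left (show Commute (α : A) d from W.cxy))
  have hb : b * ↑α⁻¹ = q ^ 2 • (↑α⁻¹ * b) := by
    calc b * ↑α⁻¹ = ↑α⁻¹ * (α * b) * ↑α⁻¹ := by simp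
      _ = _ := by rw [W.w1]; simp [mul_assoc]
  have hUV : b * (↑α⁻¹ * d) = q ^ 2 • ((↑α⁻¹ * d) * b) := by
    rw [← mul_assoc, hb, smul_mul_assoc, mul_assoc, mul_assoc, W.cyy]
  rw [hy, qb_frob hN hp hUV, hc.mul_pow, mul_add, add_comm]
  congr 1
  rw [← mul_assoc, ← Units.val_pow_eq_pow_val, ← Units.val_pow_eq_pow_val, ← Units.val_mul]
  simp

theorem TRel.pows {q : ℂ} {N : ℕ} (hN : 1 ≤ N) (hq : q ≠ 0)
    (hqN : q ^ N = (-1 : ℂ) ^ (N + 1)) (hp : IsPrimitiveRoot (q ^ 2) N)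
    {x1 y1 x2 y2 a b c d : A} (w : W2 q x1 y1 x2 y2) (W : W2 q a b c d)
    (h : TRel q x1 y1 x2 y2 a b c d) :
    x2 ^ N = a ^ N * c ^ N ∧ x1 ^ N * y2 ^ N = d ^ N ∧
    a ^ N * b ^ N = x1 ^ N * y1 ^ N * (x2 ^ N * y2 ^ N) ∧
    a ^ N * y2 ^ N = d ^ N + a ^ N * b ^ N := by
  refine ⟨?_, ?_, ?_, ?_⟩
  · rw [h.r1]; exact (show Commute a c from W.cxx).mul_pow N
  · rw [← h.r2]; exact ((show Commute x1 y2 from w.cxy).mul_pow N).symm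
  · rw [← weyl_pow' hN hq hqN W.w1, ← weyl_pow' hN hq hqN w.w1, ← weyl_pow' hN hq hqN w.w2]
    rw [← Commute.mul_pow]
    · rw [h.r4]; congr 1; simp only [smul_mul_assoc, mul_smul_comm, mul_assoc]
    · apply Commute.smul_left; apply Commute.smul_right
      exact Commute.mul_left (Commute.mul_right w.cxx w.cxy) (Commute.mul_right w.cyx w.cyy)
  · exact frob_y hN hp W (h.key hq w)
end ring

section std
variable {N : ℕ} [NeZero N] {q : ℂ}

abbrev ee (N : ℕ) (k : ZMod N) : CN N := Pi.single k 1

theorem opA_ee (k : ZMod N) : opA q N (ee N k) = (q ^ 2) ^ k.val • ee N k := by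
  funext j
  by_cases h : j = k
  · subst h; simp [opA, pow_mul]
  · simp [opA, h]

theorem opB_ee (k : ZMod N) : opB N (ee N k) = ee N (k + 1) := by
  funext j
  by_cases h : j = k + 1
  · subst h; simp [opB]
  · have : j - 1 ≠ k := fun h' => h (by rw [← h']; ring)
    simp [opB, h, this]

theorem ee_ext {W : Type*} [AddCommMonoid W] [Module ℂ W] {f g : CN N →ₗ[ℂ] W}
    (h : ∀ k, f (ee N k) = g (ee N k)) : f = g := by
  apply LinearMap.pi_ext'
  intro k
  ext
  simpa using h k

theorem chi_add (hp : IsPrimitiveRoot (q ^ 2) N) (a b : ZMod N) :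
    (q ^ 2) ^ (a + b).val = (q ^ 2) ^ a.val * (q ^ 2) ^ b.val := by
  rw [ZMod.val_add, ← pow_add]
  conv_rhs => rw [← Nat.mod_add_div (a.val + b.val) N, pow_add, pow_mul, hp.pow_eq_one, one_pow,
    mul_one]

theorem chi_succ (hp : IsPrimitiveRoot (q ^ 2) N) (a : ZMod N) :
    (q ^ 2) ^ (a + 1).val = (q ^ 2) ^ a.val * (q ^ 2) := by
  rw [chi_add hp]
  congr 1
  rw [ZMod.val_one_eq_one_mod]
  conv_rhs => rw [← pow_one (q ^ 2), ← Nat.mod_add_div 1 N, pow_add, pow_mul, hp.pow_eq_one,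
    one_pow, mul_one]

theorem chi_inj (hp : IsPrimitiveRoot (q ^ 2) N) {a b : ZMod N}
    (h : (q ^ 2) ^ a.val = (q ^ 2) ^ b.val) : a = b :=
  ZMod.val_injective N (hp.pow_inj (ZMod.val_lt a) (ZMod.val_lt b) h)

theorem opA_opB (hp : IsPrimitiveRoot (q ^ 2) N) :
    opA q N * opB N = q ^ 2 • (opB N * opA q N) := by
  apply ee_ext
  intro k
  simp only [Module.End.mul_apply, LinearMap.smul_apply, opA_ee, opB_ee, map_smul, chi_succ hp,
    smul_smul]
  rw [mul_comm]

theorem opB_pow (n : ℕ) (k : ZMod N) : (opB N ^ n) (ee N k) = ee N (k + n) := by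
  induction n with
  | zero => simp
  | succ n ih => rw [pow_succ', Module.End.mul_apply, ih, opB_ee]; congr 1; push_cast; ring

theorem opA_pow (n : ℕ) (k : ZMod N) :
    (opA q N ^ n) (ee N k) = ((q ^ 2) ^ k.val) ^ n • ee N k := by
  induction n with
  | zero => simp
  | succ n ih => rw [pow_succ', Module.End.mul_apply, ih, map_smul, opA_ee, smul_smul, ← pow_succ]

theorem opB_N : opB N ^ N = 1 := by
  apply ee_ext; intro k; rw [opB_pow]; simp

theorem opA_N (hp : IsPrimitiveRoot (q ^ 2) N) : opA q N ^ N = 1 := by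
  apply ee_ext; intro k
  rw [opA_pow, ← pow_mul, mul_comm, pow_mul, hp.pow_eq_one]; simp

theorem isUnit_of_pow {A : Type*} [Ring A] [Algebra ℂ A] {x : A} {s : ℂ} (hs : s ≠ 0)
    (h : x ^ N = s • 1) : IsUnit x := by
  have : IsUnit (x ^ N) := by
    rw [h, ← Algebra.algebraMap_eq_smul_one]
    exact (isUnit_iff_ne_zero.2 hs).map (algebraMap ℂ A)
  exact (isUnit_pow_iff (NeZero.ne N)).1 this

theorem stdA_N (hp : IsPrimitiveRoot (q ^ 2) N) (u : ℂ) : (u • opA q N) ^ N = u ^ N • 1 := by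
  rw [smul_pow, opA_N hp]
theorem stdB_N (u : ℂ) : (u • opB N) ^ N = u ^ N • 1 := by
  rw [smul_pow, opB_N]

theorem std_weyl (hp : IsPrimitiveRoot (q ^ 2) N) {u v : ℂ} (hu : u ≠ 0) (hv : v ≠ 0) :
    IsWeylPair q (u • opA q N) (v • opB N) := by
  refine ⟨isUnit_of_pow (pow_ne_zero N hu) (stdA_N hp u), isUnit_of_pow (pow_ne_zero N hv)
    (stdB_N v), ?_⟩
  simp only [smul_mul_assoc, mul_smul_comm, opA_opB hp]
  simp only [smul_smul]
  congr 1; ring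

/-- Lemma C -/
theorem tens_ext {M W : Type*} [AddCommGroup M] [Module ℂ M] [AddCommGroup W] [Module ℂ W]
    {f g : M ⊗[ℂ] CN N →ₗ[ℂ] W} (h : ∀ m k, f (m ⊗ₜ ee N k) = g (m ⊗ₜ ee N k)) : f = g := by
  apply TensorProduct.ext
  ext m : 1
  exact ee_ext (h m)

theorem tens_sum {M : Type*} [AddCommGroup M] [Module ℂ M] (t : M ⊗[ℂ] CN N) :
    t = ∑ k, (piScalarRight ℂ ℂ M (ZMod N) t k) ⊗ₜ[ℂ] ee N k := by
  apply (piScalarRight ℂ ℂ M (ZMod N)).injective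
  rw [map_sum]
  funext j
  simp only [Finset.sum_apply, piScalarRight_apply, piScalarRightHom_tmul, ee]
  rw [Finset.sum_eq_single j]
  · simp
  · intro b _ hb; simp [Pi.single_apply, hb.symm]
  · simp

theorem lemC (hp : IsPrimitiveRoot (q ^ 2) N) {u v : ℂ} (hu : u ≠ 0) (hv : v ≠ 0)
    {M M' : Type*} [AddCommGroup M] [Module ℂ M] [AddCommGroup M'] [Module ℂ M']
    (T : M ⊗[ℂ] CN N →ₗ[ℂ] M' ⊗[ℂ] CN N)
    (hA : ∀ t, T (map LinearMap.id (u • opA q N) t) = map LinearMap.id (u • opA q N) (T t))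
    (hB : ∀ t, T (map LinearMap.id (v • opB N) t) = map LinearMap.id (v • opB N) (T t)) :
    ∃ R : M →ₗ[ℂ] M', T = map R LinearMap.id := by
  have hA' : ∀ t, T (map LinearMap.id (opA q N) t) = map LinearMap.id (opA q N) (T t) := by
    intro t
    have := hA t
    simp only [map_smul_right, LinearMap.smul_apply, map_smul] at this
    exact smul_right_injective _ hu this
  have hB' : ∀ t, T (map LinearMap.id (opB N) t) = map LinearMap.id (opB N) (T t) := by
    intro t
    have := hB t
    simp only [map_smul_right, LinearMap.smul_apply, map_smul] at this
    exact smul_right_injective _ hv this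
  have pA : ∀ (t : M' ⊗[ℂ] CN N) (k : ZMod N),
      piScalarRight ℂ ℂ M' (ZMod N) (map LinearMap.id (opA q N) t) k =
      (q ^ 2) ^ k.val • piScalarRight ℂ ℂ M' (ZMod N) t k := by
    intro t k
    induction t with
    | zero => simp
    | add x y hx hy => simp only [map_add, Pi.add_apply, hx, hy, smul_add]
    | tmul x f => simp [opA, smul_smul, pow_mul]
  let R : M →ₗ[ℂ] M' := LinearMap.proj 0 ∘ₗ (piScalarRight ℂ ℂ M' (ZMod N)).toLinearMap ∘ₗ T ∘ₗ
    (TensorProduct.mk ℂ M (CN N)).flip (ee N 0)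
  have h0 : ∀ m, T (m ⊗ₜ ee N 0) = R m ⊗ₜ ee N 0 := by
    intro m
    rw [tens_sum (T (m ⊗ₜ ee N 0)), Finset.sum_eq_single 0]
    · rfl
    · intro k _ hk
      have h1 := pA (T (m ⊗ₜ ee N 0)) k
      rw [← hA', map_tmul, opA_ee] at h1
      simp only [ZMod.val_zero, pow_zero, one_smul, LinearMap.id_apply] at h1
      have h2 : (1 - (q ^ 2) ^ k.val) • piScalarRight ℂ ℂ M' (ZMod N) (T (m ⊗ₜ ee N 0)) k = 0 := by
        rw [sub_smul, one_smul, ← h1, sub_self]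
      rcases smul_eq_zero.1 h2 with h3 | h3
      · exfalso; apply hk; apply chi_inj hp
        rw [ZMod.val_zero, pow_zero]; exact (sub_eq_zero.1 h3).symm
      · rw [h3, zero_tmul]
    · simp
  have hn : ∀ m (n : ℕ), T (m ⊗ₜ ee N (n : ZMod N)) = R m ⊗ₜ ee N (n : ZMod N) := by
    intro m n
    induction n with
    | zero => simpa using h0 m
    | succ n ih =>
      have := hB' (m ⊗ₜ ee N (n : ZMod N))
      rw [ih, map_tmul, map_tmul, opB_ee] at this
      simpa using this
  refine ⟨R, tens_ext fun m k => ?_⟩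
  have := hn m k.val
  rw [ZMod.natCast_zmod_val] at this
  rw [this]; rfl

/-- Lemma B -/
theorem lemB (hp : IsPrimitiveRoot (q ^ 2) N) {u v : ℂ} (hu : u ≠ 0) (hv : v ≠ 0)
    {W : Type*} [AddCommGroup W] [Module ℂ W] [FiniteDimensional ℂ W] (X Y : Module.End ℂ W)
    (hXY : X * Y = q ^ 2 • (Y * X)) (hX : X ^ N = u ^ N • 1) (hY : Y ^ N = v ^ N • 1)
    (H : Submodule ℂ (CN N →ₗ[ℂ] W))
    (hH : ∀ f, f ∈ H ↔ f ∘ₗ (u • opA q N) = X ∘ₗ f ∧ f ∘ₗ (v • opB N) = Y ∘ₗ f) :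
    Function.Bijective (TensorProduct.lift H.subtype) := by
  have hlift : ∀ (f : H) w, TensorProduct.lift H.subtype (f ⊗ₜ w) = (f : CN N →ₗ[ℂ] W) w :=
    fun f w => rfl
  have hfX : ∀ (f : H) k, X ((f : CN N →ₗ[ℂ] W) (ee N k)) =
      (u * (q ^ 2) ^ k.val) • (f : CN N →ₗ[ℂ] W) (ee N k) := by
    intro f k
    have := LinearMap.congr_fun ((hH f).1 f.2).1 (ee N k)
    simp only [LinearMap.comp_apply, LinearMap.smul_apply, opA_ee, map_smul, smul_smul] at this
    exact this.symm
  have hfY : ∀ (f : H) k, Y ((f : CN N →ₗ[ℂ] W) (ee N k)) =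
      v • (f : CN N →ₗ[ℂ] W) (ee N (k + 1)) := by
    intro f k
    have := LinearMap.congr_fun ((hH f).1 f.2).2 (ee N k)
    simp only [LinearMap.comp_apply, LinearMap.smul_apply, opB_ee, map_smul] at this
    exact this.symm
  have linj : Function.Injective (fun k : ZMod N => u * (q ^ 2) ^ k.val) :=
    fun a b h => chi_inj hp (mul_left_cancel₀ hu h)
  have hXYn : ∀ n w, X ((Y ^ n) w) = ((q ^ 2) ^ n) • (Y ^ n) (X w) := fun n w =>
    LinearMap.congr_fun (comm_pow hXY n) w
  constructor
  · rw [injective_iff_map_eq_zero]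
    intro t ht
    rw [tens_sum t] at ht ⊢
    set h := piScalarRight ℂ ℂ H (ZMod N) t
    rw [map_sum] at ht
    simp only [hlift] at ht
    have ind := X.eigenspaces_iSupIndep.comp linj
    have hz : ∀ k, (h k : CN N →ₗ[ℂ] W) (ee N k) = 0 := by
      intro k
      have hd := ind k
      apply (Submodule.disjoint_def.1 hd)
      · exact Module.End.mem_eigenspace_iff.2 (hfX _ _)
      · have : (h k : CN N →ₗ[ℂ] W) (ee N k) =
          - ∑ j ∈ Finset.univ.erase k, (h j : CN N →ₗ[ℂ] W) (ee N j) := by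
          rw [eq_neg_iff_add_eq_zero]
          exact (Finset.add_sum_erase Finset.univ (fun j => (h j : CN N →ₗ[ℂ] W) (ee N j))
            (Finset.mem_univ k)).trans ht
        rw [this]
        apply Submodule.neg_mem
        apply Submodule.sum_mem
        intro j hj
        apply Submodule.mem_iSup_of_mem j
        apply Submodule.mem_iSup_of_mem (Finset.ne_of_mem_erase hj)
        exact Module.End.mem_eigenspace_iff.2 (hfX _ _)
    have hz' : ∀ k, h k = 0 := by
      intro k
      have hn : ∀ n : ℕ, (h k : CN N →ₗ[ℂ] W) (ee N (k + n)) = 0 := by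
        intro n
        induction n with
        | zero => simpa using hz k
        | succ n ih =>
          have := hfY (h k) (k + n)
          rw [ih, map_zero] at this
          have := (smul_eq_zero.1 this.symm).resolve_left hv
          simpa [add_assoc] using this
      apply Subtype.ext
      apply ee_ext
      intro j
      have := hn (j - k).val
      rw [ZMod.natCast_zmod_val, add_sub_cancel] at this
      rw [this]; rfl
    simp [hz']
  · rw [← LinearMap.range_eq_top, eq_top_iff]
    have hss : X.IsSemisimple := by
      refine Module.End.isSemisimple_of_squarefree_aeval_eq_zero
        (p := Polynomial.X ^ N - Polynomial.C (u ^ N))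
        (Polynomial.separable_X_pow_sub_C _ (by exact_mod_cast NeZero.ne N)
          (pow_ne_zero _ hu)).squarefree ?_
      rw [map_sub, map_pow, Polynomial.aeval_X, Polynomial.aeval_C, hX,
        Algebra.algebraMap_eq_smul_one, sub_self]
    rw [← hss.iSup_eigenspace_eq_top]
    apply iSup_le
    intro μ w hw
    by_cases hw0 : w = 0
    · rw [hw0]; exact Submodule.zero_mem _
    have hw := Module.End.mem_eigenspace_iff.1 hw
    have hpw : ∀ n : ℕ, (X ^ n) w = μ ^ n • w := by
      intro n
      induction n with
      | zero => simp
      | succ n ih => rw [pow_succ, Module.End.mul_apply, hw, map_smul, ih, smul_smul, pow_succ']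
    have hμ : μ ^ N = u ^ N := by
      have := hpw N
      rw [hX] at this
      simp only [LinearMap.smul_apply, Module.End.one_apply] at this
      exact (smul_left_injective ℂ hw0 this).symm
    obtain ⟨i, hi, hiu⟩ := hp.eq_pow_of_pow_eq_one (ξ := μ / u) (by
      rw [div_pow, hμ, div_self (pow_ne_zero _ hu)])
    have hμi : μ = u * (q ^ 2) ^ i := by rw [hiu]; field_simp
    obtain ⟨w0, hw0d⟩ : ∃ w0, w0 = (Y ^ (N - i)) w := ⟨_, rfl⟩
    have hXw0 : X w0 = u • w0 := by
      rw [hw0d, hXYn, hw, map_smul, smul_smul, hμi]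
      congr 1
      rw [mul_left_comm, ← pow_add, Nat.sub_add_cancel hi.le, hp.pow_eq_one, mul_one]
    -- the map
    let F : CN N →ₗ[ℂ] W := ∑ j : ZMod N,
      (LinearMap.toSpanSingleton ℂ W ((v⁻¹) ^ j.val • (Y ^ j.val) w0)) ∘ₗ LinearMap.proj j
    have hF : ∀ j, F (ee N j) = (v⁻¹) ^ j.val • (Y ^ j.val) w0 := by
      intro j
      simp only [F, LinearMap.sum_apply, LinearMap.comp_apply, LinearMap.proj_apply,
        LinearMap.toSpanSingleton_apply]
      rw [Finset.sum_eq_single j]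
      · simp
      · intro b _ hb; simp [Pi.single_apply, hb]
      · simp
    have hFH : F ∈ H := by
      rw [hH]
      constructor
      · apply ee_ext
        intro k
        simp only [LinearMap.comp_apply, LinearMap.smul_apply, opA_ee, map_smul, hF, hXYn, hXw0,
          smul_smul]
        congr 1; ring
      · apply ee_ext
        intro k
        simp only [LinearMap.comp_apply, LinearMap.smul_apply, opB_ee, map_smul, hF]
        rw [← Module.End.mul_apply, ← pow_succ']
        have hk : k.val < N := ZMod.val_lt k
        rcases Nat.lt_or_ge (k.val + 1) N with hlt | hge
        · have : (k + 1).val = k.val + 1 := by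
            rw [ZMod.val_add, ZMod.val_one_eq_one_mod, Nat.add_mod_mod, Nat.mod_eq_of_lt hlt]
          rw [this, smul_smul]
          congr 1
          rw [pow_succ]; field_simp
        · have hkN : k.val + 1 = N := by omega
          have : (k + 1).val = 0 := by
            rw [ZMod.val_add, ZMod.val_one_eq_one_mod, Nat.add_mod_mod, hkN, Nat.mod_self]
          rw [this, hkN, hY]
          simp only [pow_zero, one_smul, Module.End.one_apply, LinearMap.smul_apply, smul_smul]
          congr 1
          have : v ^ N = v ^ k.val * v := by rw [← pow_succ, hkN]
          rw [this, inv_pow, ← mul_assoc, inv_mul_cancel₀ (pow_ne_zero _ hv), one_mul]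
    refine ⟨(v ^ i * (v ^ N)⁻¹) • ((⟨F, hFH⟩ : H) ⊗ₜ ee N (i : ZMod N)), ?_⟩
    rw [map_smul, hlift]
    show _ • F (ee N (i : ZMod N)) = w
    rw [hF, ZMod.val_natCast, Nat.mod_eq_of_lt hi, hw0d, ← Module.End.mul_apply, ← pow_add,
      Nat.add_sub_cancel' hi.le, hY]
    simp only [Module.End.one_apply, LinearMap.smul_apply, smul_smul]
    have : v ^ i * (v ^ N)⁻¹ * (v⁻¹ ^ i * v ^ N) = 1 := by
      have := pow_ne_zero N hv
      have := pow_ne_zero i hv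
      rw [inv_pow]
      field_simp
    rw [this, one_smul]

/-- scalar powers -/
theorem scal_pow {w : ℂ} (hw : IsPrimitiveRoot w N) {W : Type*} [AddCommGroup W] [Module ℂ W]
    [FiniteDimensional ℂ W] (hd : Module.finrank ℂ W = N) (X Y : Module.End ℂ W)
    (hXu : IsUnit X) (hYu : IsUnit Y) (h : X * Y = w • (Y * X)) :
    ∃ s : ℂ, s ≠ 0 ∧ X ^ N = s ^ N • 1 := by
  have : Nontrivial W := Module.nontrivial_of_finrank_pos (R := ℂ) (by
    rw [hd]; exact NeZero.pos N)
  obtain ⟨μ, hμ⟩ := Module.End.exists_eigenvalue X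
  obtain ⟨x, hx⟩ := hμ.exists_hasEigenvector
  have hinjX : Function.Injective X := ((Module.End.isUnit_iff X).1 hXu).1
  have hinjY : Function.Injective Y := ((Module.End.isUnit_iff Y).1 hYu).1
  have hx1 : X x = μ • x := hx.apply_eq_smul
  have hμ0 : μ ≠ 0 := by
    rintro rfl
    rw [zero_smul] at hx1
    exact hx.2 (hinjX (by rw [hx1, map_zero]))
  have hXYn : ∀ n, X ((Y ^ n) x) = (μ * w ^ n) • (Y ^ n) x := by
    intro n
    have := LinearMap.congr_fun (comm_pow h n) x
    simp only [Module.End.mul_apply, LinearMap.smul_apply, hx1, map_smul, smul_smul] at this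
    rw [this, mul_comm]
  have hYn : ∀ n, (Y ^ n) x ≠ 0 := by
    intro n
    induction n with
    | zero => simpa using hx.2
    | succ n ih =>
      rw [pow_succ', Module.End.mul_apply]
      intro h0
      exact ih (hinjY (by rw [h0, map_zero]))
  have li : LinearIndependent ℂ (fun i : Fin N => (Y ^ (i : ℕ)) x) := by
    apply X.eigenvectors_linearIndependent' (fun i : Fin N => μ * w ^ (i : ℕ))
    · intro a b hab
      exact Fin.ext (hw.pow_inj a.2 b.2 (mul_left_cancel₀ hμ0 hab))
    · intro i
      exact ⟨Module.End.mem_eigenspace_iff.2 (hXYn i), hYn i⟩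
  haveI : Nonempty (Fin N) := ⟨0⟩
  let b := basisOfLinearIndependentOfCardEqFinrank li (by simp [hd])
  refine ⟨μ, hμ0, b.ext fun i => ?_⟩
  simp only [b, coe_basisOfLinearIndependentOfCardEqFinrank, LinearMap.smul_apply,
    Module.End.one_apply]
  have : ∀ n : ℕ, (X ^ n) ((Y ^ (i : ℕ)) x) = (μ * w ^ (i : ℕ)) ^ n • (Y ^ (i : ℕ)) x := by
    intro n
    induction n with
    | zero => simp
    | succ n ih => rw [pow_succ, Module.End.mul_apply, hXYn, map_smul, ih, smul_smul, pow_succ']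
  rw [this, mul_pow, ← pow_mul, mul_comm (i : ℕ), pow_mul, hw.pow_eq_one, one_pow, mul_one]

theorem weyl_scal (hp : IsPrimitiveRoot (q ^ 2) N) {W : Type*} [AddCommGroup W] [Module ℂ W]
    [FiniteDimensional ℂ W] (hd : Module.finrank ℂ W = N) (X Y : Module.End ℂ W)
    (h : IsWeylPair q X Y) :
    ∃ u v : ℂ, u ≠ 0 ∧ v ≠ 0 ∧ X ^ N = u ^ N • 1 ∧ Y ^ N = v ^ N • 1 := by
  obtain ⟨hX, hY, hXY⟩ := h
  obtain ⟨u, hu, hu'⟩ := scal_pow hp hd X Y hX hY hXY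
  have q2 : q ^ 2 ≠ 0 := hp.ne_zero (NeZero.ne N)
  obtain ⟨v, hv, hv'⟩ := scal_pow hp.inv hd Y X hY hX (by
    rw [hXY, smul_smul, inv_mul_cancel₀ q2, one_smul])
  exact ⟨u, v, hu, hv, hu', hv'⟩

theorem weyl_std (hp : IsPrimitiveRoot (q ^ 2) N) {W : Type*} [AddCommGroup W] [Module ℂ W]
    [FiniteDimensional ℂ W] (hd : Module.finrank ℂ W = N) (X Y : Module.End ℂ W)
    (h : IsWeylPair q X Y) {u v : ℂ} (hu : u ≠ 0) (hv : v ≠ 0)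
    (hX : X ^ N = u ^ N • 1) (hY : Y ^ N = v ^ N • 1) :
    ∃ φ : W ≃ₗ[ℂ] CN N, IntertwinesStd N (u • opA q N) (v • opB N) X Y φ := by
  let H : Submodule ℂ (CN N →ₗ[ℂ] W) :=
    { carrier := {f | f ∘ₗ (u • opA q N) = X ∘ₗ f ∧ f ∘ₗ (v • opB N) = Y ∘ₗ f}
      add_mem' := by
        rintro f g ⟨hf1, hf2⟩ ⟨hg1, hg2⟩
        constructor <;> simp only [LinearMap.add_comp, LinearMap.comp_add, hf1, hf2, hg1, hg2]
      zero_mem' := by constructor <;> simp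
      smul_mem' := by
        rintro c f ⟨hf1, hf2⟩
        exact ⟨by rw [LinearMap.smul_comp, hf1, LinearMap.comp_smul],
          by rw [LinearMap.smul_comp, hf2, LinearMap.comp_smul]⟩ }
  have hb := lemB hp hu hv X Y h.2.2 hX hY H (fun f => Iff.rfl)
  let E := LinearEquiv.ofBijective _ hb
  have hdim : Module.finrank ℂ H = 1 := by
    have := E.finrank_eq
    rw [Module.finrank_tensorProduct, hd] at this
    have h2 : Module.finrank ℂ (CN N) = N := by simp
    rw [h2] at this
    exact Nat.eq_of_mul_eq_mul_right (NeZero.pos N) (by rw [this, one_mul])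
  obtain ⟨f, hf0, hf⟩ := finrank_eq_one_iff'.1 hdim
  have hbij : Function.Bijective (f : CN N →ₗ[ℂ] W) := by
    constructor
    · rw [injective_iff_map_eq_zero]
      intro w hw
      have : E (f ⊗ₜ w) = 0 := hw
      rw [LinearEquiv.map_eq_zero_iff] at this
      funext j
      have h3 := congrFun (congrArg (piScalarRight ℂ ℂ H (ZMod N)) this) j
      rw [map_zero] at h3
      have h4 : w j • f = 0 := by simpa using h3
      exact (smul_eq_zero.1 h4).resolve_right hf0
    · intro y
      obtain ⟨t, ht⟩ := hb.2 y
      suffices hh : ∀ t, TensorProduct.lift H.subtype t ∈ LinearMap.range (f : CN N →ₗ[ℂ] W) by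
        rw [← ht]; exact hh t
      intro t
      induction t with
      | zero => simp
      | add a b ha hb => rw [map_add]; exact Submodule.add_mem _ ha hb
      | tmul g w =>
        obtain ⟨c, rfl⟩ := hf g
        exact ⟨c • w, by simp⟩
  let F := LinearEquiv.ofBijective _ hbij
  refine ⟨F.symm, fun w => ?_⟩
  obtain ⟨z, rfl⟩ := F.surjective w
  have h1 := LinearMap.congr_fun f.2.1 z
  have h2 := LinearMap.congr_fun f.2.2 z
  constructor
  · rw [LinearEquiv.symm_apply_eq, LinearEquiv.symm_apply_apply]; exact h1.symm
  · rw [LinearEquiv.symm_apply_eq, LinearEquiv.symm_apply_apply]; exact h2.symm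

end std

section ops
variable {V W V' W' : Type*} [AddCommGroup V] [Module ℂ V] [AddCommGroup W] [Module ℂ W]
  [AddCommGroup V'] [Module ℂ V'] [AddCommGroup W'] [Module ℂ W']

/-- operator on the left factor -/
def aL (V W : Type*) [AddCommGroup V] [Module ℂ V] [AddCommGroup W] [Module ℂ W] :
    Module.End ℂ V →ₐ[ℂ] Module.End ℂ (V ⊗[ℂ] W) := Module.End.rTensorAlgHom ℂ V W

/-- operator on the right factor -/
def aR (V W : Type*) [AddCommGroup V] [Module ℂ V] [AddCommGroup W] [Module ℂ W] :
    Module.End ℂ W →ₐ[ℂ] Module.End ℂ (V ⊗[ℂ] W) := Module.End.lTensorAlgHom ℂ W V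

/-- conjugation -/
def cj (e : V ≃ₗ[ℂ] W) : Module.End ℂ V →ₐ[ℂ] Module.End ℂ W := (e.conjAlgEquiv ℂ).toAlgHom

theorem aL_tmul (X : Module.End ℂ V) (v : V) (w : W) : aL V W X (v ⊗ₜ w) = X v ⊗ₜ w := rfl
theorem aR_tmul (X : Module.End ℂ W) (v : V) (w : W) : aR V W X (v ⊗ₜ w) = v ⊗ₜ X w := rfl
theorem aL_map (X : Module.End ℂ V) : aL V W X = map X LinearMap.id := rfl
theorem aR_map (X : Module.End ℂ W) : aR V W X = map LinearMap.id X := rfl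
theorem aL_aR (X : Module.End ℂ V) (Y : Module.End ℂ W) : aL V W X * aR V W Y = map X Y := by
  apply TensorProduct.ext'; intro v w; rfl
theorem aR_aL (X : Module.End ℂ V) (Y : Module.End ℂ W) : aR V W Y * aL V W X = map X Y := by
  apply TensorProduct.ext'; intro v w; rfl
theorem aL_aR_comm (X : Module.End ℂ V) (Y : Module.End ℂ W) :
    aL V W X * aR V W Y = aR V W Y * aL V W X := by rw [aL_aR, aR_aL]

theorem cj_apply (e : V ≃ₗ[ℂ] W) (X : Module.End ℂ V) (t : V) : cj e X (e t) = e (X t) := by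
  show e (X (e.symm (e t))) = _
  rw [e.symm_apply_apply]

theorem cj_eq (e : V ≃ₗ[ℂ] W) {X : Module.End ℂ V} {Y : Module.End ℂ W}
    (h : ∀ t, e (X t) = Y (e t)) : cj e X = Y := by
  ext w
  obtain ⟨t, rfl⟩ := e.surjective w
  rw [cj_apply, h]

theorem cj_inj (e : V ≃ₗ[ℂ] W) : Function.Injective (cj e) := (e.conjAlgEquiv ℂ).injective

theorem W2_tens {q : ℂ} {X Y : Module.End ℂ V} {Z T : Module.End ℂ W}
    (h : IsWeylPair q X Y) (h' : IsWeylPair q Z T) :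
    W2 q (aL V W X) (aL V W Y) (aR V W Z) (aR V W T) where
  ux1 := h.1.map _
  uy1 := h.2.1.map _
  ux2 := h'.1.map _
  uy2 := h'.2.1.map _
  w1 := by rw [← map_mul, h.2.2, map_smul, map_mul]
  w2 := by rw [← map_mul, h'.2.2, map_smul, map_mul]
  cxx := aL_aR_comm _ _
  cxy := aL_aR_comm _ _
  cyx := aL_aR_comm _ _
  cyy := aL_aR_comm _ _

/-- the tetrahedral relation for an isomorphism -/
def TL (q : ℂ) (L : V ⊗[ℂ] W ≃ₗ[ℂ] V' ⊗[ℂ] W') (x1 y1 : Module.End ℂ V) (x2 y2 : Module.End ℂ W)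
    (a b : Module.End ℂ V') (c d : Module.End ℂ W') : Prop :=
  TRel q (cj L (aL V W x1)) (cj L (aL V W y1)) (cj L (aR V W x2)) (cj L (aR V W y2))
    (aL V' W' a) (aL V' W' b) (aR V' W' c) (aR V' W' d)

section
variable {P Q P' Q' : Type*} [AddCommGroup P] [Module ℂ P] [AddCommGroup Q] [Module ℂ Q]
  [AddCommGroup P'] [Module ℂ P'] [AddCommGroup Q'] [Module ℂ Q']

/-- transport: from K to L -/
theorem TL.congr {q : ℂ} {L : V ⊗[ℂ] W ≃ₗ[ℂ] V' ⊗[ℂ] W'} {K : P ⊗[ℂ] Q ≃ₗ[ℂ] P' ⊗[ℂ] Q'}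
    {x1 y1 : Module.End ℂ V} {x2 y2 : Module.End ℂ W}
    {a b : Module.End ℂ V'} {c d : Module.End ℂ W'}
    {X1 Y1 : Module.End ℂ P} {X2 Y2 : Module.End ℂ Q}
    {A B : Module.End ℂ P'} {C D : Module.End ℂ Q'}
    (e1 : V ≃ₗ[ℂ] P) (e2 : W ≃ₗ[ℂ] Q) (f1 : V' ≃ₗ[ℂ] P') (f2 : W' ≃ₗ[ℂ] Q') (s : ℂ)
    (hx1 : ∀ t, e1 (x1 t) = X1 (e1 t)) (hy1 : ∀ t, e1 (y1 t) = Y1 (e1 t))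
    (hx2 : ∀ t, e2 (x2 t) = X2 (e2 t)) (hy2 : ∀ t, e2 (y2 t) = Y2 (e2 t))
    (ha : ∀ t, f1 (a t) = A (f1 t)) (hb : ∀ t, f1 (b t) = B (f1 t))
    (hc : ∀ t, f2 (c t) = C (f2 t)) (hd : ∀ t, f2 (d t) = D (f2 t))
    (h : ∀ t, TensorProduct.congr f1 f2 (L t) = s • K (TensorProduct.congr e1 e2 t))
    (H : TL q K X1 Y1 X2 Y2 A B C D) : TL q L x1 y1 x2 y2 a b c d := by
  have key : ∀ (x : Module.End ℂ (V ⊗[ℂ] W)) (X : Module.End ℂ (P ⊗[ℂ] Q)),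
      (∀ t, TensorProduct.congr e1 e2 (x t) = X (TensorProduct.congr e1 e2 t)) →
      cj (TensorProduct.congr f1 f2) (cj L x) = cj K X := by
    intro x X hxX
    apply cj_eq
    intro t
    obtain ⟨t, rfl⟩ := L.surjective t
    rw [cj_apply, h, h, map_smul, cj_apply, hxX]
  have kl : ∀ {x : Module.End ℂ V} {X : Module.End ℂ P}, (∀ t, e1 (x t) = X (e1 t)) →
      cj (TensorProduct.congr f1 f2) (cj L (aL V W x)) = cj K (aL P Q X) := by
    intro x X hh
    apply key
    intro t
    induction t with
    | zero => simp
    | add a b ha hb => simp only [map_add, ha, hb]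
    | tmul v w => simp only [aL_tmul, TensorProduct.congr_tmul, hh]
  have kr : ∀ {x : Module.End ℂ W} {X : Module.End ℂ Q}, (∀ t, e2 (x t) = X (e2 t)) →
      cj (TensorProduct.congr f1 f2) (cj L (aR V W x)) = cj K (aR P Q X) := by
    intro x X hh
    apply key
    intro t
    induction t with
    | zero => simp
    | add a b ha hb => simp only [map_add, ha, hb]
    | tmul v w => simp only [aR_tmul, TensorProduct.congr_tmul, hh]
  have kl' : ∀ {x : Module.End ℂ V'} {X : Module.End ℂ P'}, (∀ t, f1 (x t) = X (f1 t)) →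
      cj (TensorProduct.congr f1 f2) (aL V' W' x) = aL P' Q' X := by
    intro x X hh
    apply cj_eq
    intro t
    induction t with
    | zero => simp
    | add a b ha hb => simp only [map_add, ha, hb]
    | tmul v w => simp only [aL_tmul, TensorProduct.congr_tmul, hh]
  have kr' : ∀ {x : Module.End ℂ W'} {X : Module.End ℂ Q'}, (∀ t, f2 (x t) = X (f2 t)) →
      cj (TensorProduct.congr f1 f2) (aR V' W' x) = aR P' Q' X := by
    intro x X hh
    apply cj_eq
    intro t
    induction t with
    | zero => simp
    | add a b ha hb => simp only [map_add, ha, hb]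
    | tmul v w => simp only [aR_tmul, TensorProduct.congr_tmul, hh]
  apply TRel.of_map (cj (TensorProduct.congr f1 f2)) (cj_inj _)
  rw [kl hx1, kl hy1, kr hx2, kr hy2, kl' ha, kl' hb, kr' hc, kr' hd]
  exact H

/-- two isomorphisms to the same space with the same relations intertwine -/
theorem TL.inter {q : ℂ} (hq : q ≠ 0) {L : V ⊗[ℂ] W ≃ₗ[ℂ] V' ⊗[ℂ] W'}
    {K : P ⊗[ℂ] Q ≃ₗ[ℂ] V' ⊗[ℂ] W'}
    {x1 y1 : Module.End ℂ V} {x2 y2 : Module.End ℂ W}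
    {a b : Module.End ℂ V'} {c d : Module.End ℂ W'}
    {X1 Y1 : Module.End ℂ P} {X2 Y2 : Module.End ℂ Q}
    (h1 : IsWeylPair q x1 y1) (h2 : IsWeylPair q x2 y2)
    (H1 : IsWeylPair q X1 Y1) (H2 : IsWeylPair q X2 Y2) (ha : IsUnit a)
    (h : TL q L x1 y1 x2 y2 a b c d) (H : TL q K X1 Y1 X2 Y2 a b c d) :
    (∀ t, K.symm (L (aL V W x1 t)) = aL P Q X1 (K.symm (L t))) ∧
    (∀ t, K.symm (L (aL V W y1 t)) = aL P Q Y1 (K.symm (L t))) ∧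
    (∀ t, K.symm (L (aR V W x2 t)) = aR P Q X2 (K.symm (L t))) ∧
    (∀ t, K.symm (L (aR V W y2 t)) = aR P Q Y2 (K.symm (L t))) := by
  obtain ⟨e1, e2, e3, e4⟩ := TRel.uniq hq ((W2_tens h1 h2).map (cj L)) ((W2_tens H1 H2).map (cj K))
    (ha.map (aL V' W')) h H
  have key : ∀ (x : Module.End ℂ (V ⊗[ℂ] W)) (X : Module.End ℂ (P ⊗[ℂ] Q)), cj L x = cj K X →
      ∀ t, K.symm (L (x t)) = X (K.symm (L t)) := by
    intro x X e t
    rw [LinearEquiv.symm_apply_eq, ← cj_apply, ← cj_apply, e, LinearEquiv.apply_symm_apply]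
  exact ⟨key _ _ e1, key _ _ e2, key _ _ e3, key _ _ e4⟩

end

theorem tmul_zero_left {v : V} {w : W} (hw : w ≠ 0) (h : v ⊗ₜ[ℂ] w = 0) : v = 0 := by
  obtain ⟨g, hg⟩ := Module.Projective.exists_dual_ne_zero ℂ hw
  have := congrArg (fun t => TensorProduct.rid ℂ V (LinearMap.lTensor V g t)) h
  simp only [LinearMap.lTensor_tmul, TensorProduct.rid_tmul, map_zero] at this
  exact (smul_eq_zero.1 this).resolve_left hg

theorem map_id_inj [Nontrivial W] {x y : V →ₗ[ℂ] V'}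
    (h : map x (LinearMap.id : W →ₗ[ℂ] W) = map y LinearMap.id) : x = y := by
  obtain ⟨w, hw⟩ := exists_ne (0 : W)
  ext v
  have := LinearMap.congr_fun h (v ⊗ₜ w)
  rw [map_tmul, map_tmul, ← sub_eq_zero, ← sub_tmul] at this
  exact sub_eq_zero.1 (tmul_zero_left hw this)

theorem aL_inj [Nontrivial W] : Function.Injective (aL V W) := fun _ _ h => map_id_inj h

theorem map_id_bij [Nontrivial W] [FiniteDimensional ℂ V] [FiniteDimensional ℂ W]
    [FiniteDimensional ℂ V'] {x : V →ₗ[ℂ] V'}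
    (h : Function.Bijective (map x (LinearMap.id : W →ₗ[ℂ] W))) : Function.Bijective x := by
  have hd := (LinearEquiv.ofBijective _ h).finrank_eq
  rw [Module.finrank_tensorProduct, Module.finrank_tensorProduct] at hd
  have hd' : Module.finrank ℂ V = Module.finrank ℂ V' :=
    Nat.eq_of_mul_eq_mul_right Module.finrank_pos hd
  have hi : Function.Injective x := by
    rw [injective_iff_map_eq_zero]
    intro v hv
    obtain ⟨w, hw⟩ := exists_ne (0 : W)
    apply tmul_zero_left hw
    apply h.1
    rw [map_tmul, hv, map_zero, zero_tmul]
  exact ⟨hi, (LinearMap.injective_iff_surjective_of_finrank_eq_finrank hd').1 hi⟩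

theorem smul_one_inj {A : Type*} [Ring A] [Algebra ℂ A] [Nontrivial A] {s t : ℂ}
    (h : s • (1 : A) = t • 1) : s = t := by
  rw [← Algebra.algebraMap_eq_smul_one, ← Algebra.algebraMap_eq_smul_one] at h
  exact (algebraMap ℂ A).injective h

/-- power relations -/
theorem TL.scal [Nontrivial (V' ⊗[ℂ] W')] {q : ℂ} {N : ℕ} (hN : 1 ≤ N) (hq : q ≠ 0)
    (hqN : q ^ N = (-1 : ℂ) ^ (N + 1)) (hp : IsPrimitiveRoot (q ^ 2) N)
    {L : V ⊗[ℂ] W ≃ₗ[ℂ] V' ⊗[ℂ] W'}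
    {x1 y1 : Module.End ℂ V} {x2 y2 : Module.End ℂ W}
    {a b : Module.End ℂ V'} {c d : Module.End ℂ W'}
    (h1 : IsWeylPair q x1 y1) (h2 : IsWeylPair q x2 y2)
    (h3 : IsWeylPair q a b) (h4 : IsWeylPair q c d)
    (h : TL q L x1 y1 x2 y2 a b c d) {ξ η ξ' η' α β γ δ : ℂ}
    (e1 : x1 ^ N = ξ • 1) (e2 : y1 ^ N = η • 1) (e3 : x2 ^ N = ξ' • 1) (e4 : y2 ^ N = η' • 1)
    (e5 : a ^ N = α • 1) (e6 : b ^ N = β • 1) (e7 : c ^ N = γ • 1) (e8 : d ^ N = δ • 1) :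
    ξ' = α * γ ∧ ξ * η' = δ ∧ α * β = ξ * η * (ξ' * η') ∧ α * η' = δ + α * β := by
  obtain ⟨p1, p2, p3, p4⟩ := TRel.pows hN hq hqN hp ((W2_tens h1 h2).map (cj L)) (W2_tens h3 h4) h
  simp only [← map_pow, e1, e2, e3, e4, e5, e6, e7, e8, map_smul, map_one, smul_mul_smul_comm,
    mul_one, ← add_smul] at p1 p2 p3 p4
  exact ⟨smul_one_inj p1, smul_one_inj p2, smul_one_inj p3, smul_one_inj p4⟩

end ops

/-- group structure on subspaces -/
abbrev iH (N : ℕ) (H : Submodule ℂ (CN N →ₗ[ℂ] (CN N ⊗[ℂ] CN N))) : AddCommGroup H :=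
  Module.addCommMonoidToAddCommGroup ℂ

section cg
attribute [local instance] iH
variable {N : ℕ} [NeZero N] {q : ℂ}

theorem inv_mul_self {A : Type*} [Ring A] {x : A} (h : IsUnit x) : Ring.inverse x * x = 1 :=
  Ring.inverse_mul_cancel x h
theorem self_mul_inv {A : Type*} [Ring A] {x : A} (h : IsUnit x) : x * Ring.inverse x = 1 :=
  Ring.mul_inverse_cancel x h

theorem finrank_CN : Module.finrank ℂ (CN N) = N := by simp

theorem CG_main (hq : q ≠ 0) (hp : IsPrimitiveRoot (q ^ 2) N)
    {u v u' v' u'' v'' : ℂ} (hu : u ≠ 0) (hv : v ≠ 0) (hu' : u' ≠ 0) (hv' : v' ≠ 0)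
    (hu'' : u'' ≠ 0) (hv'' : v'' ≠ 0) (eu : u'' ^ N = u ^ N * u' ^ N)
    (ev : v'' ^ N = (u ^ N)⁻¹ * v' ^ N + v ^ N)
    (H : Submodule ℂ (CN N →ₗ[ℂ] (CN N ⊗[ℂ] CN N)))
    (hH : H = CGsub N (u • opA q N) (v • opB N) (u' • opA q N)
          (v' • opB N) (u'' • opA q N) (v'' • opB N)) :
    ∃ (Ω : H ⊗[ℂ] CN N ≃ₗ[ℂ] CN N ⊗[ℂ] CN N) (Xh Yh : Module.End ℂ H),
      (∀ t, Ω t = TensorProduct.lift H.subtype t) ∧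
      (∀ f : H, ((Xh f : H) : CN N →ₗ[ℂ] CN N ⊗[ℂ] CN N) =
        Ring.inverse (Pop N (u • opA q N) (v • opB N) (v' • opB N)) ∘ₗ
          (f : CN N →ₗ[ℂ] CN N ⊗[ℂ] CN N)) ∧
      (∀ f : H, ((Yh f : H) : CN N →ₗ[ℂ] CN N ⊗[ℂ] CN N) =
        Qop N q (v • opB N) (u' • opA q N) (v' • opB N) ∘ₗ
          (f : CN N →ₗ[ℂ] CN N ⊗[ℂ] CN N)) ∧
      IsWeylPair q Xh Yh ∧ Module.finrank ℂ H = N ∧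
      TL (V := H) (W := CN N) (V' := CN N) (W' := CN N) q Ω Xh Yh (u'' • opA q N) (v'' • opB N) (u • opA q N) (v • opB N)
        (u' • opA q N) (v' • opB N) := by
  have hN : 1 ≤ N := NeZero.pos N
  have hw := std_weyl hp hu hv
  have hw' := std_weyl hp hu' hv'
  have hw'' := std_weyl hp hu'' hv''
  have pX := stdA_N hp u
  have pY := stdB_N (N := N) v
  have pX' := stdA_N hp u'
  have pY' := stdB_N (N := N) v'
  generalize u • opA q N = X at *
  generalize v • opB N = Y at *
  generalize u' • opA q N = X' at *
  generalize v' • opB N = Y' at *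
  have W := W2_tens hw hw'
  set a := aL (CN N) (CN N) X with ha
  set b := aL (CN N) (CN N) Y with hb
  set c := aR (CN N) (CN N) X' with hc
  set d := aR (CN N) (CN N) Y' with hd
  obtain ⟨x2, hx2⟩ : ∃ x2 : Module.End ℂ (CN N ⊗[ℂ] CN N), x2 = TensorProduct.map X X' := ⟨_, rfl⟩
  obtain ⟨y2, hy2⟩ : ∃ y2 : Module.End ℂ (CN N ⊗[ℂ] CN N),
      y2 = TensorProduct.map (Ring.inverse X) Y' + TensorProduct.map Y 1 :=
    ⟨_, rfl⟩
  have e1 : x2 = a * c := by rw [hx2, ha, hc, aL_aR]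
  have e2 : a * y2 = d + a * b := by
    rw [hy2, mul_add, ← aL_aR, ha, hb, hd, ← mul_assoc, ← map_mul, self_mul_inv hw.1, map_one,
      one_mul]
    rfl
  have py2 : y2 ^ N = v'' ^ N • 1 := by
    have := frob_y hN hp W e2
    rw [ha, hb, hd, ← map_pow, ← map_pow, ← map_pow, pX, pY, pY'] at this
    simp only [map_smul, map_one, smul_mul_smul_comm, mul_one, ← add_smul] at this
    rw [smul_mul_assoc, one_mul] at this
    have h2 : y2 ^ N = (u ^ N)⁻¹ • (u ^ N • y2 ^ N) := by
      rw [smul_smul, inv_mul_cancel₀ (pow_ne_zero _ hu), one_smul]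
    rw [h2, this, smul_smul, ev]
    congr 1
    have := pow_ne_zero N hu
    field_simp
  have px2 : x2 ^ N = u'' ^ N • 1 := by
    rw [e1, (show Commute a c from W.cxx).mul_pow, ha, hc, ← map_pow, ← map_pow, pX, pX']
    simp only [map_smul, map_one, smul_mul_smul_comm, mul_one, eu]
  have uy2 : IsUnit y2 := isUnit_of_pow (A := Module.End ℂ (CN N ⊗[ℂ] CN N))
    (pow_ne_zero N hv'') py2
  obtain ⟨P, hP⟩ : ∃ P : Module.End ℂ (CN N ⊗[ℂ] CN N), P = Pop N X Y Y' := ⟨_, rfl⟩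
  obtain ⟨Q, hQ⟩ : ∃ Q : Module.End ℂ (CN N ⊗[ℂ] CN N), Q = Qop N q Y X' Y' := ⟨_, rfl⟩
  have hPd : P * d = y2 := by
    rw [hP, Pop, hd, add_mul, hy2]
    have e1 : TensorProduct.map (Ring.inverse X) 1 * aR (CN N) (CN N) Y' =
      TensorProduct.map (Ring.inverse X) Y' := by
      apply TensorProduct.ext'; intro v w; rfl
    have e2 : TensorProduct.map Y (Ring.inverse Y') * aR (CN N) (CN N) Y' =
      TensorProduct.map Y 1 := by
      rw [← aL_aR, mul_assoc, ← map_mul, inv_mul_self hw'.2.1, aL_aR]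
    rw [e1, e2]
  have uP : IsUnit P := by
    have : P = y2 * Ring.inverse d := by
      rw [← hPd, mul_assoc, self_mul_inv W.uy2, mul_one]
    rw [this]
    exact uy2.mul W.uy2.ringInverse
  have e3 : Ring.inverse P * y2 = d := by
    rw [← hPd, ← mul_assoc, inv_mul_self (A := Module.End ℂ (CN N ⊗[ℂ] CN N)) uP, one_mul]
  have e4 : q • (Q * d * c) = b := by
    have : Ring.inverse X' * Ring.inverse Y' * (Y' * X') = 1 := by
      rw [mul_assoc, ← mul_assoc (Ring.inverse Y'), inv_mul_self hw'.2.1, one_mul,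
        inv_mul_self hw'.1]
    rw [hQ, Qop, hd, hc, hb, ← aL_aR, mul_assoc, ← map_mul, smul_mul_assoc, mul_assoc, ← map_mul,
      this, map_one, mul_one, smul_smul, mul_inv_cancel₀ hq, one_smul]
  obtain ⟨W', T⟩ := W2.a_y2 hq W uy2 e1 e2 e3 e4
  have hmem : ∀ f, f ∈ H ↔ f ∘ₗ (u'' • opA q N) = x2 ∘ₗ f ∧ f ∘ₗ (v'' • opB N) = y2 ∘ₗ f := by
    intro f
    rw [hx2, hy2, hH]; exact Iff.rfl
  have hbij := lemB hp hu'' hv'' x2 y2 W'.w2 px2 py2 H hmem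
  -- preserve
  have pres : ∀ Z : Module.End ℂ (CN N ⊗[ℂ] CN N), Z * x2 = x2 * Z → Z * y2 = y2 * Z →
      ∃ Zh : Module.End ℂ H, ∀ f : H, ((Zh f : H) : CN N →ₗ[ℂ] CN N ⊗[ℂ] CN N) =
        Z ∘ₗ (f : CN N →ₗ[ℂ] CN N ⊗[ℂ] CN N) := by
    intro Z h1 h2
    have hm : ∀ f ∈ H, (LinearMap.compRight ℂ Z) f ∈ H := by
      intro f hf
      obtain ⟨hf1, hf2⟩ := (hmem f).1 hf
      refine (hmem _).2 ⟨?_, ?_⟩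
      · show (Z ∘ₗ f) ∘ₗ _ = x2 ∘ₗ (Z ∘ₗ f)
        rw [LinearMap.comp_assoc, hf1, ← LinearMap.comp_assoc, ← LinearMap.comp_assoc]
        exact congrArg (· ∘ₗ f) h1
      · show (Z ∘ₗ f) ∘ₗ _ = y2 ∘ₗ (Z ∘ₗ f)
        rw [LinearMap.comp_assoc, hf2, ← LinearMap.comp_assoc, ← LinearMap.comp_assoc]
        exact congrArg (· ∘ₗ f) h2
    exact ⟨LinearMap.restrict (LinearMap.compRight ℂ Z) hm, fun f => rfl⟩
  obtain ⟨Xh, hXh⟩ := pres (Ring.inverse P) W'.cxx W'.cxy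
  obtain ⟨Yh, hYh⟩ := pres Q W'.cyx W'.cyy
  have unit_of : ∀ (Z : Module.End ℂ (CN N ⊗[ℂ] CN N)) (Zh : Module.End ℂ H), IsUnit Z →
      (∀ f : H, ((Zh f : H) : CN N →ₗ[ℂ] CN N ⊗[ℂ] CN N) =
        Z ∘ₗ (f : CN N →ₗ[ℂ] CN N ⊗[ℂ] CN N)) → IsUnit Zh := by
    intro Z Zh hZ h
    rw [LinearMap.isUnit_iff_ker_eq_bot, LinearMap.ker_eq_bot']
    intro f hf
    have h1 := h f
    rw [hf] at h1
    apply Subtype.ext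
    apply LinearMap.ext
    intro w
    apply ((Module.End.isUnit_iff Z).1 hZ).1
    have := LinearMap.congr_fun h1 w
    simpa using this.symm
  let Ω := LinearEquiv.ofBijective _ hbij
  have hΩ : ∀ (f : H) w, Ω (f ⊗ₜ w) = (f : CN N →ₗ[ℂ] CN N ⊗[ℂ] CN N) w := fun f w => rfl
  have cl : ∀ (Z : Module.End ℂ (CN N ⊗[ℂ] CN N)) (Zh : Module.End ℂ H),
      (∀ f : H, ((Zh f : H) : CN N →ₗ[ℂ] CN N ⊗[ℂ] CN N) =
        Z ∘ₗ (f : CN N →ₗ[ℂ] CN N ⊗[ℂ] CN N)) → cj Ω (aL H (CN N) Zh) = Z := by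
    intro Z Zh h
    apply cj_eq
    intro t
    induction t with
    | zero => simp
    | add a b ha hb => simp only [map_add, ha, hb]
    | tmul f w => rw [aL_tmul, hΩ, hΩ, h]; rfl
  have cr : ∀ (Z : Module.End ℂ (CN N ⊗[ℂ] CN N)) (Zh : Module.End ℂ (CN N)),
      (∀ f : H, (f : CN N →ₗ[ℂ] CN N ⊗[ℂ] CN N) ∘ₗ Zh =
        Z ∘ₗ (f : CN N →ₗ[ℂ] CN N ⊗[ℂ] CN N)) → cj Ω (aR H (CN N) Zh) = Z := by
    intro Z Zh h
    apply cj_eq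
    intro t
    induction t with
    | zero => simp
    | add a b ha hb => simp only [map_add, ha, hb]
    | tmul f w => rw [aR_tmul, hΩ, hΩ]; exact LinearMap.congr_fun (h f) w
  refine ⟨Ω, Xh, Yh, fun t => rfl, ?_, ?_, ⟨unit_of _ _ uP.ringInverse hXh,
    unit_of _ _ W'.uy1 hYh, ?_⟩, ?_, ?_⟩
  · rw [← hP]; exact hXh
  · rw [← hQ]; exact hYh
  · ext1 f
    apply Subtype.ext
    have h3 := congrArg (· ∘ₗ (f : CN N →ₗ[ℂ] CN N ⊗[ℂ] CN N)) W'.w1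
    simp only [Module.End.mul_apply, LinearMap.smul_apply, Submodule.coe_smul, hXh, hYh]
    exact h3
  · have := Ω.finrank_eq
    rw [Module.finrank_tensorProduct, Module.finrank_tensorProduct, finrank_CN] at this
    exact Nat.eq_of_mul_eq_mul_right (NeZero.pos N) this
  · show TRel _ _ _ _ _ _ _ _ _
    rw [cl _ _ hXh, cl _ _ hYh, cr x2 _ (fun f => ((hmem f).1 f.2).1),
      cr y2 _ (fun f => ((hmem f).1 f.2).2)]
    exact T

end cg

section nat
variable {U V W V' W' : Type*} [AddCommGroup U] [Module ℂ U]
  [AddCommGroup V] [Module ℂ V] [AddCommGroup W] [Module ℂ W]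
  [AddCommGroup V'] [Module ℂ V'] [AddCommGroup W'] [Module ℂ W']

theorem cj_eq2 (e : V ⊗[ℂ] W ≃ₗ[ℂ] U) {X : Module.End ℂ (V ⊗[ℂ] W)} {Y : Module.End ℂ U}
    (h : ∀ v w, e (X (v ⊗ₜ w)) = Y (e (v ⊗ₜ w))) : cj e X = Y := by
  apply cj_eq
  intro t
  induction t with
  | zero => simp
  | add a b ha hb => simp only [map_add, ha, hb]
  | tmul v w => exact h v w

theorem cj_eq3 (e : (V ⊗[ℂ] W) ⊗[ℂ] V' ≃ₗ[ℂ] U) {X : Module.End ℂ ((V ⊗[ℂ] W) ⊗[ℂ] V')}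
    {Y : Module.End ℂ U}
    (h : ∀ v w z, e (X ((v ⊗ₜ w) ⊗ₜ z)) = Y (e ((v ⊗ₜ w) ⊗ₜ z))) : cj e X = Y := by
  apply cj_eq2
  intro t z
  induction t with
  | zero => simp
  | add a b ha hb => simp only [add_tmul, map_add, ha, hb]
  | tmul v w => exact h v w z

theorem cj_eq3' (e : V ⊗[ℂ] (W ⊗[ℂ] V') ≃ₗ[ℂ] U) {X : Module.End ℂ (V ⊗[ℂ] (W ⊗[ℂ] V'))}
    {Y : Module.End ℂ U}
    (h : ∀ v w z, e (X (v ⊗ₜ (w ⊗ₜ z))) = Y (e (v ⊗ₜ (w ⊗ₜ z)))) : cj e X = Y := by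
  apply cj_eq2
  intro z t
  induction t with
  | zero => simp
  | add a b ha hb => simp only [tmul_add, map_add, ha, hb]
  | tmul v w => exact h z v w

theorem cj_trans (e : U ≃ₗ[ℂ] V) (f : V ≃ₗ[ℂ] W) (X : Module.End ℂ U) :
    cj (e.trans f) X = cj f (cj e X) := rfl

theorem cjr_R (e : W ≃ₗ[ℂ] W') (X : Module.End ℂ W) :
    cj (TensorProduct.congr (LinearEquiv.refl ℂ V) e) (aR V W X) = aR V W' (cj e X) :=
  cj_eq2 _ fun v w => by simp [aR_tmul, cj_apply]
theorem cjr_L (e : W ≃ₗ[ℂ] W') (X : Module.End ℂ V) :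
    cj (TensorProduct.congr (LinearEquiv.refl ℂ V) e) (aL V W X) = aL V W' X :=
  cj_eq2 _ fun v w => by simp [aL_tmul]
theorem cjl_L (e : V ≃ₗ[ℂ] V') (X : Module.End ℂ V) :
    cj (TensorProduct.congr e (LinearEquiv.refl ℂ W)) (aL V W X) = aL V' W (cj e X) :=
  cj_eq2 _ fun v w => by simp [aL_tmul, cj_apply]
theorem cjl_R (e : V ≃ₗ[ℂ] V') (X : Module.End ℂ W) :
    cj (TensorProduct.congr e (LinearEquiv.refl ℂ W)) (aR V W X) = aR V' W X :=
  cj_eq2 _ fun v w => by simp [aR_tmul]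
theorem cjc_L (X : Module.End ℂ V) : cj (TensorProduct.comm ℂ V W) (aL V W X) = aR W V X :=
  cj_eq2 _ fun v w => by simp [aL_tmul, aR_tmul]
theorem cjc_R (X : Module.End ℂ W) : cj (TensorProduct.comm ℂ V W) (aR V W X) = aL W V X :=
  cj_eq2 _ fun v w => by simp [aL_tmul, aR_tmul]
theorem cja_LL (X : Module.End ℂ U) :
    cj (TensorProduct.assoc ℂ U V W) (aL _ W (aL U V X)) = aL U _ X :=
  cj_eq3 _ fun v w z => by simp [aL_tmul]
theorem cja_LR (X : Module.End ℂ V) :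
    cj (TensorProduct.assoc ℂ U V W) (aL _ W (aR U V X)) = aR U _ (aL V W X) :=
  cj_eq3 _ fun v w z => by simp [aL_tmul, aR_tmul]
theorem cja_R (X : Module.End ℂ W) :
    cj (TensorProduct.assoc ℂ U V W) (aR _ W X) = aR U _ (aR V W X) :=
  cj_eq3 _ fun v w z => by simp [aR_tmul]
theorem cjs_L (X : Module.End ℂ U) :
    cj (TensorProduct.assoc ℂ U V W).symm (aL U _ X) = aL _ W (aL U V X) :=
  cj_eq3' _ fun v w z => by simp [aL_tmul]
theorem cjs_RL (X : Module.End ℂ V) :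
    cj (TensorProduct.assoc ℂ U V W).symm (aR U _ (aL V W X)) = aL _ W (aR U V X) :=
  cj_eq3' _ fun v w z => by simp [aL_tmul, aR_tmul]
theorem cjs_RR (X : Module.End ℂ W) :
    cj (TensorProduct.assoc ℂ U V W).symm (aR U _ (aR V W X)) = aR _ W X :=
  cj_eq3' _ fun v w z => by simp [aR_tmul]
theorem cjm_L (X : Module.End ℂ U) :
    cj (TensorProduct.leftComm ℂ U V W) (aL U _ X) = aR V _ (aL U W X) :=
  cj_eq3' _ fun v w z => by simp [aL_tmul, aR_tmul]
theorem cjm_RL (X : Module.End ℂ V) :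
    cj (TensorProduct.leftComm ℂ U V W) (aR U _ (aL V W X)) = aL V _ X :=
  cj_eq3' _ fun v w z => by simp [aL_tmul, aR_tmul]
theorem cjm_RR (X : Module.End ℂ W) :
    cj (TensorProduct.leftComm ℂ U V W) (aR U _ (aR V W X)) = aR V _ (aR U W X) :=
  cj_eq3' _ fun v w z => by simp [aR_tmul]
end nat

section six
variable {H1 H2 K1 K2 C1 C2 C3 C12 C23 C : Type*}
  [AddCommGroup H1] [Module ℂ H1] [AddCommGroup H2] [Module ℂ H2]
  [AddCommGroup K1] [Module ℂ K1] [AddCommGroup K2] [Module ℂ K2]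
  [AddCommGroup C1] [Module ℂ C1] [AddCommGroup C2] [Module ℂ C2] [AddCommGroup C3] [Module ℂ C3]
  [AddCommGroup C12] [Module ℂ C12] [AddCommGroup C23] [Module ℂ C23] [AddCommGroup C] [Module ℂ C]

/-- first bracketing -/
def Ephi (Ω1 : H1 ⊗[ℂ] C12 ≃ₗ[ℂ] C1 ⊗[ℂ] C2) (Ω2 : H2 ⊗[ℂ] C ≃ₗ[ℂ] C12 ⊗[ℂ] C3) :
    (H1 ⊗[ℂ] H2) ⊗[ℂ] C ≃ₗ[ℂ] C1 ⊗[ℂ] (C2 ⊗[ℂ] C3) :=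
  (TensorProduct.assoc ℂ H1 H2 C).trans
    ((TensorProduct.congr (LinearEquiv.refl ℂ H1) Ω2).trans
      ((TensorProduct.assoc ℂ H1 C12 C3).symm.trans
        ((TensorProduct.congr Ω1 (LinearEquiv.refl ℂ C3)).trans (TensorProduct.assoc ℂ C1 C2 C3))))

/-- second bracketing -/
def Epsi (Ω1 : K1 ⊗[ℂ] C ≃ₗ[ℂ] C1 ⊗[ℂ] C23) (Ω2 : K2 ⊗[ℂ] C23 ≃ₗ[ℂ] C2 ⊗[ℂ] C3) :
    (K1 ⊗[ℂ] K2) ⊗[ℂ] C ≃ₗ[ℂ] C1 ⊗[ℂ] (C2 ⊗[ℂ] C3) :=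
  (TensorProduct.congr (TensorProduct.comm ℂ K1 K2) (LinearEquiv.refl ℂ C)).trans
    ((TensorProduct.assoc ℂ K2 K1 C).trans
      ((TensorProduct.congr (LinearEquiv.refl ℂ K2) Ω1).trans
        ((TensorProduct.leftComm ℂ K2 C1 C23).trans
          (TensorProduct.congr (LinearEquiv.refl ℂ C1) Ω2))))

theorem sixj_gen {q : ℂ} (hq : q ≠ 0)
    (Ω1 : H1 ⊗[ℂ] C12 ≃ₗ[ℂ] C1 ⊗[ℂ] C2) (Ω2 : H2 ⊗[ℂ] C ≃ₗ[ℂ] C12 ⊗[ℂ] C3)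
    (Ω3 : K1 ⊗[ℂ] C ≃ₗ[ℂ] C1 ⊗[ℂ] C23) (Ω4 : K2 ⊗[ℂ] C23 ≃ₗ[ℂ] C2 ⊗[ℂ] C3)
    {xh1 yh1 : Module.End ℂ H1} {xh2 yh2 : Module.End ℂ H2} {xk1 yk1 : Module.End ℂ K1}
    {xk2 yk2 : Module.End ℂ K2} {x1 y1 : Module.End ℂ C1} {x2 y2 : Module.End ℂ C2}
    {x3 y3 : Module.End ℂ C3} {x12 y12 : Module.End ℂ C12} {x23 y23 : Module.End ℂ C23}
    {x y : Module.End ℂ C}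
    (wh1 : IsWeylPair q xh1 yh1) (wh2 : IsWeylPair q xh2 yh2)
    (wk1 : IsWeylPair q xk1 yk1) (wk2 : IsWeylPair q xk2 yk2)
    (w1 : IsWeylPair q x1 y1) (w2 : IsWeylPair q x2 y2) (w3 : IsWeylPair q x3 y3)
    (w12 : IsWeylPair q x12 y12) (w23 : IsWeylPair q x23 y23) (w : IsWeylPair q x y)
    (T1 : TL q Ω1 xh1 yh1 x12 y12 x1 y1 x2 y2) (T2 : TL q Ω2 xh2 yh2 x y x12 y12 x3 y3)
    (T3 : TL q Ω3 xk1 yk1 x y x1 y1 x23 y23) (T4 : TL q Ω4 xk2 yk2 x23 y23 x2 y2 x3 y3) :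
    cj (Ephi Ω1 Ω2) (aR _ C x) = cj (Epsi Ω3 Ω4) (aR _ C x) ∧
    cj (Ephi Ω1 Ω2) (aR _ C y) = cj (Epsi Ω3 Ω4) (aR _ C y) ∧
    TRel q (cj (Ephi Ω1 Ω2) (aL _ C (aL H1 H2 xh1))) (cj (Ephi Ω1 Ω2) (aL _ C (aL H1 H2 yh1)))
      (cj (Ephi Ω1 Ω2) (aL _ C (aR H1 H2 xh2))) (cj (Ephi Ω1 Ω2) (aL _ C (aR H1 H2 yh2)))
      (cj (Epsi Ω3 Ω4) (aL _ C (aL K1 K2 xk1))) (cj (Epsi Ω3 Ω4) (aL _ C (aL K1 K2 yk1)))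
      (cj (Epsi Ω3 Ω4) (aL _ C (aR K1 K2 xk2))) (cj (Epsi Ω3 Ω4) (aL _ C (aR K1 K2 yk2))) := by
  let α1 : Module.End ℂ (C12 ⊗[ℂ] C3) →ₐ[ℂ] Module.End ℂ (C1 ⊗[ℂ] (C2 ⊗[ℂ] C3)) :=
    (cj (TensorProduct.assoc ℂ C1 C2 C3)).comp
      ((cj (TensorProduct.congr Ω1 (LinearEquiv.refl ℂ C3))).comp
        ((cj (TensorProduct.assoc ℂ H1 C12 C3).symm).comp (aR H1 _)))
  let α2 : Module.End ℂ (C1 ⊗[ℂ] C2) →ₐ[ℂ] Module.End ℂ (C1 ⊗[ℂ] (C2 ⊗[ℂ] C3)) :=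
    (cj (TensorProduct.assoc ℂ C1 C2 C3)).comp (aL _ C3)
  let α3 : Module.End ℂ (C1 ⊗[ℂ] C23) →ₐ[ℂ] Module.End ℂ (C1 ⊗[ℂ] (C2 ⊗[ℂ] C3)) :=
    (cj (TensorProduct.congr (LinearEquiv.refl ℂ C1) Ω4)).comp
      ((cj (TensorProduct.leftComm ℂ K2 C1 C23)).comp (aR K2 _))
  let α4 : Module.End ℂ (C2 ⊗[ℂ] C3) →ₐ[ℂ] Module.End ℂ (C1 ⊗[ℂ] (C2 ⊗[ℂ] C3)) := aR C1 _
  have R1 := TRel.map α1 T2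
  have R2 := TRel.map α2 T1
  have R3 := TRel.map α3 T3
  have R4 := TRel.map α4 T4
  have K1' := R1.key hq (((W2_tens wh2 w).map (cj Ω2)).map α1)
  have K2' := R2.key hq (((W2_tens wh1 w12).map (cj Ω1)).map α2)
  have K3' := R3.key hq (((W2_tens wk1 w).map (cj Ω3)).map α3)
  have K4' := R4.key hq (((W2_tens wk2 w23).map (cj Ω4)).map α4)
  have cm : ∀ z, α2 (cj Ω1 (aR H1 C12 z)) = α1 (aL C12 C3 z) := fun z => by
    simp only [α1, α2, AlgHom.comp_apply, cjs_RL, cjl_L]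
  have c3 : ∀ z, α1 (aR C12 C3 z) = aR _ _ (aR _ _ z) := fun z => by
    simp only [α1, AlgHom.comp_apply, cjs_RR, cjl_R, cja_R]
  have c3' : ∀ z, α4 (aR C2 C3 z) = aR _ _ (aR _ _ z) := fun z => rfl
  have cs : ∀ z, α3 (aR C1 C23 z) = α4 (cj Ω4 (aR K2 C23 z)) := fun z => by
    simp only [α3, α4, AlgHom.comp_apply, cjm_RR, cjr_R]
  have c1 : ∀ z, α2 (aL C1 C2 z) = aL _ _ z := fun z => by
    simp only [α2, AlgHom.comp_apply, cja_LL]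
  have c1' : ∀ z, α3 (aL C1 C23 z) = aL _ _ z := fun z => by
    simp only [α3, AlgHom.comp_apply, cjm_RL, cjr_L]
  have c2 : ∀ z, α2 (aR C1 C2 z) = aR _ _ (aL _ _ z) := fun z => by
    simp only [α2, AlgHom.comp_apply, cja_LR]
  have c2' : ∀ z, α4 (aL C2 C3 z) = aR _ _ (aL _ _ z) := fun z => rfl
  have p1 : ∀ z, cj (Ephi Ω1 Ω2) (aL _ C (aL H1 H2 z)) = α2 (cj Ω1 (aL H1 C12 z)) := fun z => by
    simp only [Ephi, cj_trans, α2, AlgHom.comp_apply, cja_LL, cjr_L, cjs_L, cjl_L]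
  have p2 : ∀ z, cj (Ephi Ω1 Ω2) (aL _ C (aR H1 H2 z)) = α1 (cj Ω2 (aL H2 C z)) := fun z => by
    simp only [Ephi, cj_trans, α1, AlgHom.comp_apply, cja_LR, cjr_R]
  have p3 : ∀ z, cj (Ephi Ω1 Ω2) (aR _ C z) = α1 (cj Ω2 (aR H2 C z)) := fun z => by
    simp only [Ephi, cj_trans, α1, AlgHom.comp_apply, cja_R, cjr_R]
  have s1 : ∀ z, cj (Epsi Ω3 Ω4) (aL _ C (aL K1 K2 z)) = α3 (cj Ω3 (aL K1 C z)) := fun z => by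
    simp only [Epsi, cj_trans, α3, AlgHom.comp_apply, cjl_L, cjc_L, cja_LR, cjr_R]
  have s2 : ∀ z, cj (Epsi Ω3 Ω4) (aL _ C (aR K1 K2 z)) = α4 (cj Ω4 (aL K2 C23 z)) := fun z => by
    simp only [Epsi, cj_trans, α4, cjl_L, cjc_R, cja_LL, cjr_L, cjm_L, cjr_R]
  have s3 : ∀ z, cj (Epsi Ω3 Ω4) (aR _ C z) = α3 (cj Ω3 (aR K1 C z)) := fun z => by
    simp only [Epsi, cj_trans, α3, AlgHom.comp_apply, cjl_R, cja_R, cjr_R]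
  simp only [cm, cs, c3, c3', c1, c1', c2, c2', ← p1, ← p2, ← p3, ← s1, ← s2, ← s3]
    at R1 R2 R3 R4 K1' K2' K3' K4'
  have hx : cj (Ephi Ω1 Ω2) (aR _ C x) = cj (Epsi Ω3 Ω4) (aR _ C x) := by
    rw [R1.r1, R2.r1, R3.r1, R4.r1, mul_assoc]
  have hac : aL C1 (C2 ⊗[ℂ] C3) x1 * aR C1 _ (aL C2 C3 x2) =
    aR C1 _ (aL C2 C3 x2) * aL C1 (C2 ⊗[ℂ] C3) x1 := aL_aR_comm _ _
  have hy : cj (Ephi Ω1 Ω2) (aR _ C y) = cj (Epsi Ω3 Ω4) (aR _ C y) := by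
    apply ((w1.1.map (aL C1 (C2 ⊗[ℂ] C3))).mul ((w2.1.map (aL C2 C3)).map (aR C1 _))).mul_left_cancel
    rw [← R2.r1, K1', R2.r1, hac, mul_assoc, mul_assoc, K3', K2', mul_add, mul_add, ← add_assoc,
      K4']
  refine ⟨hx, hy, ?_⟩
  rw [← hx, ← hy] at R3
  refine sixj_ring hq R1 R2 R3 R4 ?_ ?_ ?_ ?_ ?_ ?_ ?_ ?_ ?_ ?_
  · exact ((wh2.1.map _).map _).map _
  · exact (w.1.map _).map _
  · exact (w.2.1.map _).map _
  · rw [← map_mul, ← map_mul, aL_aR_comm, map_mul, map_mul]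
  · rw [p1, ← cm, ← map_mul, ← map_mul, aL_aR_comm, map_mul, map_mul]
  · rw [← map_mul, ← map_mul, aL_aR_comm, map_mul, map_mul]
  · rw [← map_mul, ← map_mul, aL_aR_comm, map_mul, map_mul]
  · rw [hx, ← map_mul, aL_aR_comm, map_mul]
  · rw [s2]; exact aL_aR_comm _ _
  · rw [s2]; exact aL_aR_comm _ _
end six

section sixN
variable {N : ℕ} [NeZero N] {q : ℂ}
variable {H1 H2 K1 K2 C1 C2 C3 C12 C23 : Type*}
  [AddCommGroup H1] [Module ℂ H1] [AddCommGroup H2] [Module ℂ H2]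
  [AddCommGroup K1] [Module ℂ K1] [AddCommGroup K2] [Module ℂ K2]
  [FiniteDimensional ℂ H1] [FiniteDimensional ℂ H2] [FiniteDimensional ℂ K1]
  [FiniteDimensional ℂ K2]
  [AddCommGroup C1] [Module ℂ C1] [AddCommGroup C2] [Module ℂ C2] [AddCommGroup C3] [Module ℂ C3]
  [AddCommGroup C12] [Module ℂ C12] [AddCommGroup C23] [Module ℂ C23]

theorem sixj_R (hq : q ≠ 0) (hp : IsPrimitiveRoot (q ^ 2) N) {u v : ℂ} (hu : u ≠ 0) (hv : v ≠ 0)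
    (Ω1 : H1 ⊗[ℂ] C12 ≃ₗ[ℂ] C1 ⊗[ℂ] C2) (Ω2 : H2 ⊗[ℂ] CN N ≃ₗ[ℂ] C12 ⊗[ℂ] C3)
    (Ω3 : K1 ⊗[ℂ] CN N ≃ₗ[ℂ] C1 ⊗[ℂ] C23) (Ω4 : K2 ⊗[ℂ] C23 ≃ₗ[ℂ] C2 ⊗[ℂ] C3)
    {xh1 yh1 : Module.End ℂ H1} {xh2 yh2 : Module.End ℂ H2} {xk1 yk1 : Module.End ℂ K1}
    {xk2 yk2 : Module.End ℂ K2} {x1 y1 : Module.End ℂ C1} {x2 y2 : Module.End ℂ C2}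
    {x3 y3 : Module.End ℂ C3} {x12 y12 : Module.End ℂ C12} {x23 y23 : Module.End ℂ C23}
    (wh1 : IsWeylPair q xh1 yh1) (wh2 : IsWeylPair q xh2 yh2)
    (wk1 : IsWeylPair q xk1 yk1) (wk2 : IsWeylPair q xk2 yk2)
    (w1 : IsWeylPair q x1 y1) (w2 : IsWeylPair q x2 y2) (w3 : IsWeylPair q x3 y3)
    (w12 : IsWeylPair q x12 y12) (w23 : IsWeylPair q x23 y23)
    (T1 : TL q Ω1 xh1 yh1 x12 y12 x1 y1 x2 y2)
    (T2 : TL q Ω2 xh2 yh2 (u • opA q N) (v • opB N) x12 y12 x3 y3)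
    (T3 : TL q Ω3 xk1 yk1 (u • opA q N) (v • opB N) x1 y1 x23 y23)
    (T4 : TL q Ω4 xk2 yk2 x23 y23 x2 y2 x3 y3) :
    ∃ R : H1 ⊗[ℂ] H2 ≃ₗ[ℂ] K1 ⊗[ℂ] K2,
      (∀ t w, Epsi Ω3 Ω4 (R t ⊗ₜ w) = Ephi Ω1 Ω2 (t ⊗ₜ w)) ∧
      TL q R xh1 yh1 xh2 yh2 xk1 yk1 xk2 yk2 := by
  obtain ⟨hx, hy, T⟩ := sixj_gen hq Ω1 Ω2 Ω3 Ω4 wh1 wh2 wk1 wk2 w1 w2 w3 w12 w23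
    (std_weyl hp hu hv) T1 T2 T3 T4
  set F := Ephi Ω1 Ω2
  set G := Epsi Ω3 Ω4
  have key : ∀ z, cj F (aR _ (CN N) z) = cj G (aR _ (CN N) z) → ∀ t,
      (F.trans G.symm) (map LinearMap.id z t) = map LinearMap.id z ((F.trans G.symm) t) := by
    intro z hz t
    rw [LinearEquiv.trans_apply, LinearEquiv.trans_apply, LinearEquiv.symm_apply_eq]
    have h1 := cj_apply F (aR _ (CN N) z) t
    have h2 := cj_apply G (aR _ (CN N) z) (G.symm (F t))
    rw [hz, ← G.apply_symm_apply (F t), h2] at h1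
    exact h1.symm
  obtain ⟨R, hR⟩ := lemC hp hu hv (F.trans G.symm).toLinearMap (key _ hx) (key _ hy)
  have hb : Function.Bijective (map R (LinearMap.id : CN N →ₗ[ℂ] CN N)) := by
    rw [← hR]; exact (F.trans G.symm).bijective
  have hRb := map_id_bij hb
  have hE : ∀ t w, G (R t ⊗ₜ w) = F (t ⊗ₜ w) := by
    intro t w
    have := LinearMap.congr_fun hR (t ⊗ₜ w)
    rw [map_tmul, LinearMap.id_apply] at this
    rw [← this]
    exact G.apply_symm_apply _
  let Re := LinearEquiv.ofBijective R hRb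
  refine ⟨Re, hE, ?_⟩
  have tr : ∀ z, cj G (aL _ (CN N) (cj Re z)) = cj F (aL _ (CN N) z) := by
    intro z
    symm
    apply cj_eq2
    intro t w
    rw [aL_tmul, ← hE, ← hE, cj_apply, aL_tmul]
    congr 2
    exact (cj_apply Re z t).symm
  apply TRel.of_map ((cj G).comp (aL _ (CN N))) ((cj_inj G).comp aL_inj)
  simp only [AlgHom.comp_apply, tr]
  exact T
end sixN

section gen
variable {N : ℕ} [NeZero N] {q : ℂ}
variable {V W V' W' P Q P' Q' : Type*} [AddCommGroup V] [Module ℂ V] [AddCommGroup W] [Module ℂ W]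
  [AddCommGroup V'] [Module ℂ V'] [AddCommGroup W'] [Module ℂ W']
  [AddCommGroup P] [Module ℂ P] [AddCommGroup Q] [Module ℂ Q]
  [AddCommGroup P'] [Module ℂ P'] [AddCommGroup Q'] [Module ℂ Q']

theorem gen_fwd {L : V ⊗[ℂ] W →ₗ[ℂ] V' ⊗[ℂ] W'} {K : P ⊗[ℂ] Q ≃ₗ[ℂ] P' ⊗[ℂ] Q'}
    {x1 y1 : Module.End ℂ V} {x2 y2 : Module.End ℂ W}
    {a b : Module.End ℂ V'} {c d : Module.End ℂ W'}
    {X1 Y1 : Module.End ℂ P} {X2 Y2 : Module.End ℂ Q}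
    {A B : Module.End ℂ P'} {C D : Module.End ℂ Q'}
    (e1 : V ≃ₗ[ℂ] P) (e2 : W ≃ₗ[ℂ] Q) (f1 : V' ≃ₗ[ℂ] P') (f2 : W' ≃ₗ[ℂ] Q') {s : ℂ} (hs : s ≠ 0)
    (hx1 : ∀ t, e1 (x1 t) = X1 (e1 t)) (hy1 : ∀ t, e1 (y1 t) = Y1 (e1 t))
    (hx2 : ∀ t, e2 (x2 t) = X2 (e2 t)) (hy2 : ∀ t, e2 (y2 t) = Y2 (e2 t))
    (ha : ∀ t, f1 (a t) = A (f1 t)) (hb : ∀ t, f1 (b t) = B (f1 t))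
    (hc : ∀ t, f2 (c t) = C (f2 t)) (hd : ∀ t, f2 (d t) = D (f2 t))
    (h : ∀ t, map f1.toLinearMap f2.toLinearMap (L t) =
      s • K (map e1.toLinearMap e2.toLinearMap t))
    (H : TL q K X1 Y1 X2 Y2 A B C D) :
    ∃ Le : V ⊗[ℂ] W ≃ₗ[ℂ] V' ⊗[ℂ] W', (∀ t, Le t = L t) ∧ TL q Le x1 y1 x2 y2 a b c d := by
  let Ke := ((TensorProduct.congr e1 e2).trans K).trans
    ((LinearEquiv.smulOfNeZero ℂ (P' ⊗[ℂ] Q') s hs).trans (TensorProduct.congr f1 f2).symm)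
  have hK : ∀ t, Ke t = L t := by
    intro t
    apply (TensorProduct.congr f1 f2).injective
    show TensorProduct.congr f1 f2 ((TensorProduct.congr f1 f2).symm _) = _
    rw [LinearEquiv.apply_symm_apply]
    exact (h t).symm
  refine ⟨Ke, hK, TL.congr e1 e2 f1 f2 s hx1 hy1 hx2 hy2 ha hb hc hd ?_ H⟩
  intro t
  rw [hK]
  exact h t

theorem cj_scal {e : V ≃ₗ[ℂ] W} {x : Module.End ℂ V} {X : Module.End ℂ W}
    (h : ∀ t, e (x t) = X (e t)) {s : ℂ} {n : ℕ} (hx : x ^ n = s • 1) : X ^ n = s • 1 := by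
  rw [← cj_eq e h, ← map_pow, hx, map_smul, map_one]

theorem gen_bwd (hN : 1 ≤ N) (hq : q ≠ 0)
    (hqN : q ^ N = (-1 : ℂ) ^ (N + 1)) (hp : IsPrimitiveRoot (q ^ 2) N)
    [FiniteDimensional ℂ V] [FiniteDimensional ℂ W] [FiniteDimensional ℂ V'] [FiniteDimensional ℂ W']
    [FiniteDimensional ℂ P] [FiniteDimensional ℂ Q]
    (L : V ⊗[ℂ] W ≃ₗ[ℂ] V' ⊗[ℂ] W') (K : P ⊗[ℂ] Q ≃ₗ[ℂ] P' ⊗[ℂ] Q')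
    {x1 y1 : Module.End ℂ V} {x2 y2 : Module.End ℂ W}
    {a b : Module.End ℂ V'} {c d : Module.End ℂ W'}
    {X1 Y1 : Module.End ℂ P} {X2 Y2 : Module.End ℂ Q}
    {A B : Module.End ℂ P'} {C D : Module.End ℂ Q'}
    (h1 : IsWeylPair q x1 y1) (h2 : IsWeylPair q x2 y2)
    (h3 : IsWeylPair q a b) (h4 : IsWeylPair q c d)
    (H1 : IsWeylPair q X1 Y1) (H2 : IsWeylPair q X2 Y2)
    (H3 : IsWeylPair q A B) (H4 : IsWeylPair q C D)
    (dV : Module.finrank ℂ V = N) (dW : Module.finrank ℂ W = N)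
    (dV' : Module.finrank ℂ V' = N) (dW' : Module.finrank ℂ W' = N)
    (dP : Module.finrank ℂ P = N) (dQ : Module.finrank ℂ Q = N)
    (f1 : V' ≃ₗ[ℂ] P') (f2 : W' ≃ₗ[ℂ] Q')
    (ha : ∀ t, f1 (a t) = A (f1 t)) (hb : ∀ t, f1 (b t) = B (f1 t))
    (hc : ∀ t, f2 (c t) = C (f2 t)) (hd : ∀ t, f2 (d t) = D (f2 t))
    (T : TL q L x1 y1 x2 y2 a b c d) (H : TL q K X1 Y1 X2 Y2 A B C D) :
    ∃ (e1 : V ≃ₗ[ℂ] P) (e2 : W ≃ₗ[ℂ] Q),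
      (∀ t, e1 (x1 t) = X1 (e1 t)) ∧ (∀ t, e1 (y1 t) = Y1 (e1 t)) ∧
      (∀ t, e2 (x2 t) = X2 (e2 t)) ∧ (∀ t, e2 (y2 t) = Y2 (e2 t)) ∧
      (∀ t, map f1.toLinearMap f2.toLinearMap (L t) = K (map e1.toLinearMap e2.toLinearMap t)) := by
  have : Nontrivial (CN N) := Module.nontrivial_of_finrank_pos (R := ℂ) (by rw [finrank_CN]; exact hN)
  have : Nontrivial (V' ⊗[ℂ] W') := Module.nontrivial_of_finrank_pos (R := ℂ) (by
    rw [Module.finrank_tensorProduct, dV', dW']; positivity)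
  have : Nontrivial (P' ⊗[ℂ] Q') := (TensorProduct.congr f1 f2).injective.nontrivial
  obtain ⟨s1, t1, hs1, ht1, e1, e2⟩ := weyl_scal hp dV x1 y1 h1
  obtain ⟨s2, t2, hs2, ht2, e3, e4⟩ := weyl_scal hp dW x2 y2 h2
  obtain ⟨s3, t3, hs3, ht3, e5, e6⟩ := weyl_scal hp dV' a b h3
  obtain ⟨s4, t4, hs4, ht4, e7, e8⟩ := weyl_scal hp dW' c d h4
  obtain ⟨s5, t5, hs5, ht5, e9, e10⟩ := weyl_scal hp dP X1 Y1 H1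
  obtain ⟨s6, t6, hs6, ht6, e11, e12⟩ := weyl_scal hp dQ X2 Y2 H2
  obtain ⟨p1, p2, p3, p4⟩ := TL.scal hN hq hqN hp h1 h2 h3 h4 T e1 e2 e3 e4 e5 e6 e7 e8
  obtain ⟨r1, r2, r3, r4⟩ := TL.scal hN hq hqN hp H1 H2 H3 H4 H e9 e10 e11 e12
    (cj_scal ha e5) (cj_scal hb e6) (cj_scal hc e7) (cj_scal hd e8)
  have es : s6 ^ N = s2 ^ N := by rw [p1, r1]
  have et : t6 ^ N = t2 ^ N := mul_left_cancel₀ (pow_ne_zero N hs3) (by rw [p4, r4])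
  rw [es] at e11
  rw [et] at e12
  obtain ⟨ψ, hψ⟩ := weyl_std hp dW x2 y2 h2 hs2 ht2 e3 e4
  obtain ⟨ψ', hψ'⟩ := weyl_std hp dQ X2 Y2 H2 hs2 ht2 e11 e12
  let L2 : V ⊗[ℂ] CN N ≃ₗ[ℂ] P' ⊗[ℂ] Q' :=
    ((TensorProduct.congr (LinearEquiv.refl ℂ V) ψ).symm.trans L).trans (TensorProduct.congr f1 f2)
  let K2 : P ⊗[ℂ] CN N ≃ₗ[ℂ] P' ⊗[ℂ] Q' :=
    ((TensorProduct.congr (LinearEquiv.refl ℂ P) ψ').symm.trans K)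
  have hL2 : ∀ t, L2 (TensorProduct.congr (LinearEquiv.refl ℂ V) ψ t) =
      TensorProduct.congr f1 f2 (L t) := fun t => by
    simp only [L2, LinearEquiv.trans_apply, LinearEquiv.symm_apply_apply]
  have hK2 : ∀ t, K2 (TensorProduct.congr (LinearEquiv.refl ℂ P) ψ' t) = K t := fun t => by
    simp only [K2, LinearEquiv.trans_apply, LinearEquiv.symm_apply_apply]
  have TL2 : TL q L2 x1 y1 (s2 • opA q N) (t2 • opB N) A B C D := by
    refine TL.congr (K := L) (LinearEquiv.refl ℂ V) ψ.symm f1.symm f2.symm 1 (fun _ => rfl)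
      (fun _ => rfl) ?_ ?_ ?_ ?_ ?_ ?_ ?_ T
    · intro t; rw [LinearEquiv.symm_apply_eq, (hψ _).1, LinearEquiv.apply_symm_apply]
    · intro t; rw [LinearEquiv.symm_apply_eq, (hψ _).2, LinearEquiv.apply_symm_apply]
    · intro t; rw [LinearEquiv.symm_apply_eq, ha, LinearEquiv.apply_symm_apply]
    · intro t; rw [LinearEquiv.symm_apply_eq, hb, LinearEquiv.apply_symm_apply]
    · intro t; rw [LinearEquiv.symm_apply_eq, hc, LinearEquiv.apply_symm_apply]
    · intro t; rw [LinearEquiv.symm_apply_eq, hd, LinearEquiv.apply_symm_apply]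
    · intro t
      rw [one_smul]
      exact LinearEquiv.symm_apply_apply (TensorProduct.congr f1 f2) _
  have TK2 : TL q K2 X1 Y1 (s2 • opA q N) (t2 • opB N) A B C D := by
    refine TL.congr (K := K) (LinearEquiv.refl ℂ P) ψ'.symm (LinearEquiv.refl ℂ P')
      (LinearEquiv.refl ℂ Q') 1 (fun _ => rfl)
      (fun _ => rfl) ?_ ?_ (fun _ => rfl) (fun _ => rfl) (fun _ => rfl) (fun _ => rfl) ?_ H
    · intro t; rw [LinearEquiv.symm_apply_eq, (hψ' _).1, LinearEquiv.apply_symm_apply]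
    · intro t; rw [LinearEquiv.symm_apply_eq, (hψ' _).2, LinearEquiv.apply_symm_apply]
    · intro t
      rw [one_smul, TensorProduct.congr_refl_refl]
      rfl
  have ws := std_weyl hp hs2 ht2
  obtain ⟨i1, i2, i3, i4⟩ := TL.inter hq h1 ws H1 ws H3.1 TL2 TK2
  obtain ⟨ρ, hρ⟩ := lemC hp hs2 ht2 (L2.trans K2.symm).toLinearMap i3 i4
  have hb : Function.Bijective (map ρ (LinearMap.id : CN N →ₗ[ℂ] CN N)) := by
    rw [← hρ]; exact (L2.trans K2.symm).bijective
  have hρb := map_id_bij hb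
  have hE : ∀ t, K2.symm (L2 t) = map ρ LinearMap.id t := LinearMap.congr_fun hρ
  obtain ⟨w0, hw0⟩ := exists_ne (0 : CN N)
  have hi : ∀ (x : Module.End ℂ V) (X : Module.End ℂ P),
      (∀ t, K2.symm (L2 (aL V (CN N) x t)) = aL P (CN N) X (K2.symm (L2 t))) →
      ∀ t, ρ (x t) = X (ρ t) := by
    intro x X h t
    have := h (t ⊗ₜ w0)
    rw [hE, hE, aL_tmul, map_tmul, map_tmul, aL_tmul, ← sub_eq_zero, ← sub_tmul] at this
    exact sub_eq_zero.1 (tmul_zero_left hw0 this)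
  refine ⟨LinearEquiv.ofBijective ρ hρb, ψ.trans ψ'.symm, hi _ _ i1, hi _ _ i2, ?_, ?_, ?_⟩
  · intro t
    rw [LinearEquiv.trans_apply, LinearEquiv.trans_apply, LinearEquiv.symm_apply_eq, (hψ' _).1,
      LinearEquiv.apply_symm_apply, (hψ _).1]
  · intro t
    rw [LinearEquiv.trans_apply, LinearEquiv.trans_apply, LinearEquiv.symm_apply_eq, (hψ' _).2,
      LinearEquiv.apply_symm_apply, (hψ _).2]
  · intro t
    show TensorProduct.congr f1 f2 (L t) = _
    rw [← hL2, ← hK2, ← LinearEquiv.symm_apply_eq, hE]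
    induction t with
    | zero => simp
    | add a b ha hb => simp only [map_add, ha, hb]
    | tmul v w => simp

end gen

section cg2
attribute [local instance] iH
variable {N : ℕ} [NeZero N] {q : ℂ}

theorem phi_eq (H1 H2 : Submodule ℂ (CN N →ₗ[ℂ] (CN N ⊗[ℂ] CN N)))
    (Ω1 : H1 ⊗[ℂ] CN N ≃ₗ[ℂ] CN N ⊗[ℂ] CN N) (Ω2 : H2 ⊗[ℂ] CN N ≃ₗ[ℂ] CN N ⊗[ℂ] CN N)
    (h1 : ∀ t, Ω1 t = TensorProduct.lift H1.subtype t)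
    (h2 : ∀ t, Ω2 t = TensorProduct.lift H2.subtype t) (t : H1 ⊗[ℂ] H2) (w : CN N) :
    phiL N H1 H2 t w = Ephi Ω1 Ω2 (t ⊗ₜ w) := by
  have key : ∀ (f : H1) (z : CN N ⊗[ℂ] CN N),
      TensorProduct.congr Ω1 (LinearEquiv.refl ℂ (CN N))
        ((TensorProduct.assoc ℂ H1 (CN N) (CN N)).symm (f ⊗ₜ z)) =
      map (f : CN N →ₗ[ℂ] (CN N ⊗[ℂ] CN N)) LinearMap.id z := by
    intro f z
    induction z with
    | zero => simp
    | add a b ha hb => simp only [tmul_add, map_add, ha, hb]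
    | tmul v w => simp [h1]
  induction t with
  | zero => simp
  | add a b ha hb => simp only [add_tmul, map_add, LinearMap.add_apply, ha, hb]
  | tmul f g =>
    simp only [Ephi, LinearEquiv.trans_apply, TensorProduct.assoc_tmul, TensorProduct.congr_tmul,
      LinearEquiv.refl_apply, key, h2, TensorProduct.lift.tmul]
    rfl

theorem psi_eq (H1 H2 : Submodule ℂ (CN N →ₗ[ℂ] (CN N ⊗[ℂ] CN N)))
    (Ω1 : H1 ⊗[ℂ] CN N ≃ₗ[ℂ] CN N ⊗[ℂ] CN N) (Ω2 : H2 ⊗[ℂ] CN N ≃ₗ[ℂ] CN N ⊗[ℂ] CN N)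
    (h1 : ∀ t, Ω1 t = TensorProduct.lift H1.subtype t)
    (h2 : ∀ t, Ω2 t = TensorProduct.lift H2.subtype t) (t : H1 ⊗[ℂ] H2) (w : CN N) :
    psiL N H1 H2 t w = Epsi Ω1 Ω2 (t ⊗ₜ w) := by
  have key : ∀ (f : H2) (z : CN N ⊗[ℂ] CN N),
      TensorProduct.congr (LinearEquiv.refl ℂ (CN N)) Ω2
        (TensorProduct.leftComm ℂ H2 (CN N) (CN N) (f ⊗ₜ z)) =
      map LinearMap.id (f : CN N →ₗ[ℂ] (CN N ⊗[ℂ] CN N)) z := by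
    intro f z
    induction z with
    | zero => simp
    | add a b ha hb => simp only [tmul_add, map_add, ha, hb]
    | tmul v w => simp [h2]
  induction t with
  | zero => simp
  | add a b ha hb => simp only [add_tmul, map_add, LinearMap.add_apply, ha, hb]
  | tmul f g =>
    simp only [Epsi, LinearEquiv.trans_apply, TensorProduct.assoc_tmul, TensorProduct.congr_tmul,
      LinearEquiv.refl_apply, TensorProduct.comm_tmul, key, h1, TensorProduct.lift.tmul]
    rfl

theorem sixj_CG (hq : q ≠ 0) (hp : IsPrimitiveRoot (q ^ 2) N) {u v : ℂ} (hu : u ≠ 0) (hv : v ≠ 0)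
    (H1 H2 K1 K2 : Submodule ℂ (CN N →ₗ[ℂ] (CN N ⊗[ℂ] CN N)))
    (Ω1 : H1 ⊗[ℂ] CN N ≃ₗ[ℂ] CN N ⊗[ℂ] CN N) (Ω2 : H2 ⊗[ℂ] CN N ≃ₗ[ℂ] CN N ⊗[ℂ] CN N)
    (Ω3 : K1 ⊗[ℂ] CN N ≃ₗ[ℂ] CN N ⊗[ℂ] CN N) (Ω4 : K2 ⊗[ℂ] CN N ≃ₗ[ℂ] CN N ⊗[ℂ] CN N)
    (h1 : ∀ t, Ω1 t = TensorProduct.lift H1.subtype t)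
    (h2 : ∀ t, Ω2 t = TensorProduct.lift H2.subtype t)
    (h3 : ∀ t, Ω3 t = TensorProduct.lift K1.subtype t)
    (h4 : ∀ t, Ω4 t = TensorProduct.lift K2.subtype t)
    {xh1 yh1 : Module.End ℂ H1} {xh2 yh2 : Module.End ℂ H2} {xk1 yk1 : Module.End ℂ K1}
    {xk2 yk2 : Module.End ℂ K2} {x1 y1 x2 y2 x3 y3 x12 y12 x23 y23 : Module.End ℂ (CN N)}
    (wh1 : IsWeylPair q xh1 yh1) (wh2 : IsWeylPair q xh2 yh2)
    (wk1 : IsWeylPair q xk1 yk1) (wk2 : IsWeylPair q xk2 yk2)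
    (w1 : IsWeylPair q x1 y1) (w2 : IsWeylPair q x2 y2) (w3 : IsWeylPair q x3 y3)
    (w12 : IsWeylPair q x12 y12) (w23 : IsWeylPair q x23 y23)
    (T1 : TL (V := H1) (W := CN N) (V' := CN N) (W' := CN N) q Ω1 xh1 yh1 x12 y12 x1 y1 x2 y2)
    (T2 : TL (V := H2) (W := CN N) (V' := CN N) (W' := CN N) q Ω2 xh2 yh2
      (u • opA q N) (v • opB N) x12 y12 x3 y3)
    (T3 : TL (V := K1) (W := CN N) (V' := CN N) (W' := CN N) q Ω3 xk1 yk1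
      (u • opA q N) (v • opB N) x1 y1 x23 y23)
    (T4 : TL (V := K2) (W := CN N) (V' := CN N) (W' := CN N) q Ω4 xk2 yk2 x23 y23 x2 y2 x3 y3) :
    ∃ R : H1 ⊗[ℂ] H2 ≃ₗ[ℂ] K1 ⊗[ℂ] K2,
      psiL N K1 K2 ∘ₗ R.toLinearMap = phiL N H1 H2 ∧
      (∀ R' : H1 ⊗[ℂ] H2 →ₗ[ℂ] K1 ⊗[ℂ] K2, psiL N K1 K2 ∘ₗ R' = phiL N H1 H2 →
        R' = R.toLinearMap) ∧
      TL (V := H1) (W := H2) (V' := K1) (W' := K2) q R xh1 yh1 xh2 yh2 xk1 yk1 xk2 yk2 := by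
  obtain ⟨R, hR, T⟩ := sixj_R (H1 := H1) (H2 := H2) (K1 := K1) (K2 := K2) hq hp hu hv Ω1 Ω2 Ω3 Ω4
    wh1 wh2 wk1 wk2 w1 w2 w3 w12 w23 T1 T2 T3 T4
  have e : psiL N K1 K2 ∘ₗ R.toLinearMap = phiL N H1 H2 := by
    apply LinearMap.ext; intro t
    apply LinearMap.ext; intro w
    rw [phi_eq H1 H2 Ω1 Ω2 h1 h2, ← hR, ← psi_eq K1 K2 Ω3 Ω4 h3 h4]
    rfl
  refine ⟨R, e, ?_, T⟩
  intro R' hR'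
  apply LinearMap.ext; intro t
  have nt : Nontrivial (CN N) :=
    Module.nontrivial_of_finrank_pos (R := ℂ) (by rw [finrank_CN]; exact NeZero.pos N)
  obtain ⟨w0, hw0⟩ := exists_ne (0 : CN N)
  rw [← sub_eq_zero]
  apply tmul_zero_left hw0
  apply (Epsi (K1 := K1) (K2 := K2) Ω3 Ω4).injective
  rw [map_zero, ← psi_eq K1 K2 Ω3 Ω4 h3 h4, map_sub, LinearMap.sub_apply, sub_eq_zero]
  exact LinearMap.congr_fun (LinearMap.congr_fun (hR'.trans e.symm) t) w0

end cg2

theorem nth_root (N : ℕ) (hN : 1 ≤ N) {z : ℂ} (hz : z ≠ 0) : ∃ r : ℂ, r ≠ 0 ∧ r ^ N = z := by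
  obtain ⟨r, hr⟩ := IsAlgClosed.exists_pow_nat_eq z (n := N) hN
  refine ⟨r, ?_, hr⟩
  rintro rfl
  rw [zero_pow (by omega)] at hr
  exact hz hr.symm

theorem params {a b c d : ℂ} (ha : a ≠ 0) (hb : b ≠ 0) (hc : c ≠ 0) (hd : d ≠ 0)
    (h : d + a * b ≠ 0) : ∃ x1 y1 x2 y2 x3 y3 : ℂ, x1 ≠ 0 ∧ y1 ≠ 0 ∧ x2 ≠ 0 ∧ y2 ≠ 0 ∧ x3 ≠ 0 ∧
      y3 ≠ 0 ∧ x1⁻¹ * y2 + y1 ≠ 0 ∧ x2⁻¹ * y3 + y2 = c⁻¹ ∧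
      (x1 * x2)⁻¹ * y3 + x1⁻¹ * y2 + y1 = (a * c)⁻¹ ∧ y1 * c = b * (x2 * x3) ∧ y2 = d * x3 ∧
      y3 = 1 := by
  obtain ⟨t, ht⟩ := Infinite.exists_notMem_finset ({0, (c * d)⁻¹, (c * (d + a * b))⁻¹} : Finset ℂ)
  simp only [Finset.mem_insert, Finset.mem_singleton, not_or] at ht
  obtain ⟨t0, t1, t2⟩ := ht
  have k1 : 1 - c * d * t ≠ 0 := by
    intro e
    apply t1
    apply eq_inv_of_mul_eq_one_left
    linear_combination -e
  have k2 : 1 - c * (d + a * b) * t ≠ 0 := by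
    intro e
    apply t2
    apply eq_inv_of_mul_eq_one_left
    linear_combination -e
  obtain ⟨m, hm⟩ : ∃ m, m = 1 - c * d * t := ⟨_, rfl⟩
  obtain ⟨n, hn⟩ : ∃ n, n = 1 - c * (d + a * b) * t := ⟨_, rfl⟩
  rw [← hm] at k1
  rw [← hn] at k2
  have e12 : (a * m / n)⁻¹ * (d * t) + b * t / m = t * (d + a * b) / a := by
    field_simp
    rw [hn, hm]; ring
  refine ⟨a * m / n, b * t / m, c / m, d * t, t, 1, ?_, ?_, ?_, ?_, t0, one_ne_zero, ?_, ?_, ?_,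
    ?_, rfl, rfl⟩
  · positivity
  · positivity
  · positivity
  · positivity
  · rw [e12]; exact div_ne_zero (mul_ne_zero t0 h) ha
  · field_simp
    rw [hm]; ring
  · rw [add_assoc, e12]
    field_simp
    rw [hn]; ring
  · field_simp

section main
attribute [local instance] iH
variable {N : ℕ} [NeZero N] {q : ℂ}
variable {V₁ V₂ V₁' V₂' : Type*}
    [AddCommGroup V₁] [Module ℂ V₁] [FiniteDimensional ℂ V₁]
    [AddCommGroup V₂] [Module ℂ V₂] [FiniteDimensional ℂ V₂]
    [AddCommGroup V₁'] [Module ℂ V₁'] [FiniteDimensional ℂ V₁']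
    [AddCommGroup V₂'] [Module ℂ V₂'] [FiniteDimensional ℂ V₂']

theorem weyl_iso (hp : IsPrimitiveRoot (q ^ 2) N)
    (d1 : Module.finrank ℂ V₁ = N) (d2 : Module.finrank ℂ V₂ = N)
    {X₁ Y₁ : Module.End ℂ V₁} (h₁ : IsWeylPair q X₁ Y₁)
    {X₂ Y₂ : Module.End ℂ V₂} (h₂ : IsWeylPair q X₂ Y₂)
    {u v : ℂ} (hu : u ≠ 0) (hv : v ≠ 0)
    (e1 : X₁ ^ N = u ^ N • 1) (e2 : Y₁ ^ N = v ^ N • 1)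
    (e3 : X₂ ^ N = u ^ N • 1) (e4 : Y₂ ^ N = v ^ N • 1) :
    ∃ f : V₁ ≃ₗ[ℂ] V₂, (∀ t, f (X₁ t) = X₂ (f t)) ∧ (∀ t, f (Y₁ t) = Y₂ (f t)) := by
  obtain ⟨ψ, hψ⟩ := weyl_std hp d1 _ _ h₁ hu hv e1 e2
  obtain ⟨ψ', hψ'⟩ := weyl_std hp d2 _ _ h₂ hu hv e3 e4
  refine ⟨ψ.trans ψ'.symm, ?_, ?_⟩
  · intro t
    rw [LinearEquiv.trans_apply, LinearEquiv.trans_apply, LinearEquiv.symm_apply_eq, (hψ' _).1,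
      LinearEquiv.apply_symm_apply, (hψ _).1]
  · intro t
    rw [LinearEquiv.trans_apply, LinearEquiv.trans_apply, LinearEquiv.symm_apply_eq, (hψ' _).2,
      LinearEquiv.apply_symm_apply, (hψ _).2]

/-- the common intermediate condition -/
def StarC (N : ℕ) (q : ℂ)
    (X₁ Y₁ : Module.End ℂ V₁) (X₂ Y₂ : Module.End ℂ V₂) (X₁' Y₁' : Module.End ℂ V₁')
    (X₂' Y₂' : Module.End ℂ V₂') (L : V₁ ⊗[ℂ] V₂ →ₗ[ℂ] V₁' ⊗[ℂ] V₂') : Prop :=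
  ∃ Le : V₁ ⊗[ℂ] V₂ ≃ₗ[ℂ] V₁' ⊗[ℂ] V₂', (∀ t, Le t = L t) ∧ TL q Le X₁ Y₁ X₂ Y₂ X₁' Y₁' X₂' Y₂' ∧
    Module.finrank ℂ V₁ = N ∧ Module.finrank ℂ V₂ = N ∧
    Module.finrank ℂ V₁' = N ∧ Module.finrank ℂ V₂' = N

variable {X₁ Y₁ : Module.End ℂ V₁} {X₂ Y₂ : Module.End ℂ V₂}
    {X₁' Y₁' : Module.End ℂ V₁'} {X₂' Y₂' : Module.End ℂ V₂'}
    {L : V₁ ⊗[ℂ] V₂ →ₗ[ℂ] V₁' ⊗[ℂ] V₂'}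

theorem cond1_star (hq : q ≠ 0) (hp : IsPrimitiveRoot (q ^ 2) N)
    {u v u' v' u'' v'' c : ℂ} (hu : u ≠ 0) (hv : v ≠ 0) (hu' : u' ≠ 0) (hv' : v' ≠ 0)
    (hu'' : u'' ≠ 0) (hv'' : v'' ≠ 0) (hc : c ≠ 0) (eu : u'' ^ N = u ^ N * u' ^ N)
    (ev : v'' ^ N = (u ^ N)⁻¹ * v' ^ N + v ^ N)
    (φ₁ : V₁ ≃ₗ[ℂ] ↥(CGsub N (u • opA q N) (v • opB N) (u' • opA q N)
          (v' • opB N) (u'' • opA q N) (v'' • opB N)))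
    (φ₂ : V₂ ≃ₗ[ℂ] CN N) (φ₁' : V₁' ≃ₗ[ℂ] CN N) (φ₂' : V₂' ≃ₗ[ℂ] CN N)
    (i1 : IntertwinesCG N q (u • opA q N) (v • opB N) (u' • opA q N) (v' • opB N)
          (u'' • opA q N) (v'' • opB N) X₁ Y₁ φ₁)
    (i2 : IntertwinesStd N (u'' • opA q N) (v'' • opB N) X₂ Y₂ φ₂)
    (i3 : IntertwinesStd N (u • opA q N) (v • opB N) X₁' Y₁' φ₁')
    (i4 : IntertwinesStd N (u' • opA q N) (v' • opB N) X₂' Y₂' φ₂')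
    (h : TensorProduct.map φ₁'.toLinearMap φ₂'.toLinearMap ∘ₗ L =
          c • (TensorProduct.lift (CGsub N (u • opA q N) (v • opB N) (u' • opA q N)
              (v' • opB N) (u'' • opA q N) (v'' • opB N)).subtype ∘ₗ
            TensorProduct.map φ₁.toLinearMap φ₂.toLinearMap)) :
    StarC N q X₁ Y₁ X₂ Y₂ X₁' Y₁' X₂' Y₂' L := by
  obtain ⟨Ω, Xh, Yh, hΩ, hX, hY, W, dH, T⟩ := CG_main hq hp hu hv hu' hv' hu'' hv'' eu ev _ rfl
  obtain ⟨Le, hL, TLe⟩ := gen_fwd (L := L) φ₁ φ₂ φ₁' φ₂' hc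
    (fun t => Subtype.ext (((i1 t).1).trans (hX _).symm))
    (fun t => Subtype.ext (((i1 t).2).trans (hY _).symm))
    (fun t => (i2 t).1) (fun t => (i2 t).2)
    (fun t => (i3 t).1) (fun t => (i3 t).2) (fun t => (i4 t).1) (fun t => (i4 t).2)
    (fun t => (LinearMap.congr_fun h t).trans (by rw [hΩ]; rfl)) T
  exact ⟨Le, hL, TLe, φ₁.finrank_eq.trans dH, φ₂.finrank_eq.trans finrank_CN,
    φ₁'.finrank_eq.trans finrank_CN, φ₂'.finrank_eq.trans finrank_CN⟩

theorem star_cond1 (hN : 1 ≤ N) (hq : q ≠ 0)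
    (hqN : q ^ N = (-1 : ℂ) ^ (N + 1)) (hp : IsPrimitiveRoot (q ^ 2) N)
    (h₁ : IsWeylPair q X₁ Y₁) (h₂ : IsWeylPair q X₂ Y₂)
    (h₁' : IsWeylPair q X₁' Y₁') (h₂' : IsWeylPair q X₂' Y₂')
    (S : StarC N q X₁ Y₁ X₂ Y₂ X₁' Y₁' X₂' Y₂' L) :
    ∃ u v u' v' u'' v'' c : ℂ,
      u ≠ 0 ∧ v ≠ 0 ∧ u' ≠ 0 ∧ v' ≠ 0 ∧ u'' ≠ 0 ∧ v'' ≠ 0 ∧ c ≠ 0 ∧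
      (u ^ N)⁻¹ * v' ^ N + v ^ N ≠ 0 ∧
      u'' ^ N = u ^ N * u' ^ N ∧ v'' ^ N = (u ^ N)⁻¹ * v' ^ N + v ^ N ∧
      ∃ (φ₁ : V₁ ≃ₗ[ℂ] ↥(CGsub N (u • opA q N) (v • opB N) (u' • opA q N)
          (v' • opB N) (u'' • opA q N) (v'' • opB N)))
        (φ₂ : V₂ ≃ₗ[ℂ] CN N) (φ₁' : V₁' ≃ₗ[ℂ] CN N) (φ₂' : V₂' ≃ₗ[ℂ] CN N),
        IntertwinesCG N q (u • opA q N) (v • opB N) (u' • opA q N) (v' • opB N)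
          (u'' • opA q N) (v'' • opB N) X₁ Y₁ φ₁ ∧
        IntertwinesStd N (u'' • opA q N) (v'' • opB N) X₂ Y₂ φ₂ ∧
        IntertwinesStd N (u • opA q N) (v • opB N) X₁' Y₁' φ₁' ∧
        IntertwinesStd N (u' • opA q N) (v' • opB N) X₂' Y₂' φ₂' ∧
        TensorProduct.map φ₁'.toLinearMap φ₂'.toLinearMap ∘ₗ L =
          c • (TensorProduct.lift (CGsub N (u • opA q N) (v • opB N) (u' • opA q N)
              (v' • opB N) (u'' • opA q N) (v'' • opB N)).subtype ∘ₗ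
            TensorProduct.map φ₁.toLinearMap φ₂.toLinearMap) := by
  obtain ⟨Le, hL, T, d1, d2, d3, d4⟩ := S
  have nt : Nontrivial (V₁' ⊗[ℂ] V₂') := Module.nontrivial_of_finrank_pos (R := ℂ) (by
    rw [Module.finrank_tensorProduct, d3, d4]; positivity)
  obtain ⟨s1, t1, hs1, ht1, e1, e2⟩ := weyl_scal hp d1 _ _ h₁
  obtain ⟨s2, t2, hs2, ht2, e3, e4⟩ := weyl_scal hp d2 _ _ h₂
  obtain ⟨s3, t3, hs3, ht3, e5, e6⟩ := weyl_scal hp d3 _ _ h₁'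
  obtain ⟨s4, t4, hs4, ht4, e7, e8⟩ := weyl_scal hp d4 _ _ h₂'
  obtain ⟨p1, p2, p3, p4⟩ := TL.scal hN hq hqN hp h₁ h₂ h₁' h₂' T e1 e2 e3 e4 e5 e6 e7 e8
  have ev : t2 ^ N = (s3 ^ N)⁻¹ * t4 ^ N + t3 ^ N := by
    have := pow_ne_zero N hs3
    field_simp
    linear_combination p4
  obtain ⟨Ω, Xh, Yh, hΩ, hX, hY, W, dH, TΩ⟩ := CG_main hq hp hs3 ht3 hs4 ht4 hs2 ht2 p1 ev _ rfl
  obtain ⟨f1, hf1⟩ := weyl_std hp d3 _ _ h₁' hs3 ht3 e5 e6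
  obtain ⟨f2, hf2⟩ := weyl_std hp d4 _ _ h₂' hs4 ht4 e7 e8
  obtain ⟨g1, g2, a1, a2, a3, a4, a5⟩ := gen_bwd hN hq hqN hp Le Ω h₁ h₂ h₁' h₂' W
    (std_weyl hp hs2 ht2) (std_weyl hp hs3 ht3) (std_weyl hp hs4 ht4) d1 d2 d3 d4 dH finrank_CN
    f1 f2 (fun t => (hf1 t).1) (fun t => (hf1 t).2) (fun t => (hf2 t).1) (fun t => (hf2 t).2) T TΩ
  refine ⟨s3, t3, s4, t4, s2, t2, 1, hs3, ht3, hs4, ht4, hs2, ht2, one_ne_zero, ?_, p1, ev,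
    g1, g2, f1, f2, fun w => ⟨?_, ?_⟩, fun w => ⟨a3 w, a4 w⟩, hf1, hf2, ?_⟩
  · rw [← ev]; exact pow_ne_zero N ht2
  · rw [a1, hX]
  · rw [a2, hY]
  · rw [one_smul]
    apply LinearMap.ext; intro t
    rw [LinearMap.comp_apply, ← hL, a5, hΩ]; rfl

end main

section main2
attribute [local instance] iH
variable {N : ℕ} [NeZero N] {q : ℂ}
variable {V₁ V₂ V₁' V₂' : Type*}
    [AddCommGroup V₁] [Module ℂ V₁] [FiniteDimensional ℂ V₁]
    [AddCommGroup V₂] [Module ℂ V₂] [FiniteDimensional ℂ V₂]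
    [AddCommGroup V₁'] [Module ℂ V₁'] [FiniteDimensional ℂ V₁']
    [AddCommGroup V₂'] [Module ℂ V₂'] [FiniteDimensional ℂ V₂']

variable {X₁ Y₁ : Module.End ℂ V₁} {X₂ Y₂ : Module.End ℂ V₂}
    {X₁' Y₁' : Module.End ℂ V₁'} {X₂' Y₂' : Module.End ℂ V₂'}
    {L : V₁ ⊗[ℂ] V₂ →ₗ[ℂ] V₁' ⊗[ℂ] V₂'}


theorem cond2_star (hq : q ≠ 0) (hp : IsPrimitiveRoot (q ^ 2) N)
    {u1 v1 u2 v2 u3 v3 u12 v12 u23 v23 u123 v123 c : ℂ}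
    (hu1 : u1 ≠ 0) (hv1 : v1 ≠ 0) (hu2 : u2 ≠ 0) (hv2 : v2 ≠ 0) (hu3 : u3 ≠ 0) (hv3 : v3 ≠ 0)
    (hu12 : u12 ≠ 0) (hv12 : v12 ≠ 0) (hu23 : u23 ≠ 0) (hv23 : v23 ≠ 0) (hu123 : u123 ≠ 0)
    (hv123 : v123 ≠ 0) (hc : c ≠ 0)
    (eu12 : u12 ^ N = u1 ^ N * u2 ^ N) (ev12 : v12 ^ N = (u1 ^ N)⁻¹ * v2 ^ N + v1 ^ N)
    (eu23 : u23 ^ N = u2 ^ N * u3 ^ N) (ev23 : v23 ^ N = (u2 ^ N)⁻¹ * v3 ^ N + v2 ^ N)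
    (eu123 : u123 ^ N = u1 ^ N * u2 ^ N * u3 ^ N)
    (ev123 : v123 ^ N = (u1 ^ N * u2 ^ N)⁻¹ * v3 ^ N + (u1 ^ N)⁻¹ * v2 ^ N + v1 ^ N)
    (φ₁ : V₁ ≃ₗ[ℂ] ↥(CGsub N (u1 • opA q N) (v1 • opB N) (u2 • opA q N) (v2 • opB N)
      (u12 • opA q N) (v12 • opB N)))
    (φ₂ : V₂ ≃ₗ[ℂ] ↥(CGsub N (u12 • opA q N) (v12 • opB N) (u3 • opA q N) (v3 • opB N)
      (u123 • opA q N) (v123 • opB N)))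
    (φ₁' : V₁' ≃ₗ[ℂ] ↥(CGsub N (u1 • opA q N) (v1 • opB N) (u23 • opA q N) (v23 • opB N)
      (u123 • opA q N) (v123 • opB N)))
    (φ₂' : V₂' ≃ₗ[ℂ] ↥(CGsub N (u2 • opA q N) (v2 • opB N) (u3 • opA q N) (v3 • opB N)
      (u23 • opA q N) (v23 • opB N)))
    (i1 : IntertwinesCG N q (u1 • opA q N) (v1 • opB N) (u2 • opA q N) (v2 • opB N)
      (u12 • opA q N) (v12 • opB N) X₁ Y₁ φ₁)
    (i2 : IntertwinesCG N q (u12 • opA q N) (v12 • opB N) (u3 • opA q N) (v3 • opB N)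
      (u123 • opA q N) (v123 • opB N) X₂ Y₂ φ₂)
    (i3 : IntertwinesCG N q (u1 • opA q N) (v1 • opB N) (u23 • opA q N) (v23 • opB N)
      (u123 • opA q N) (v123 • opB N) X₁' Y₁' φ₁')
    (i4 : IntertwinesCG N q (u2 • opA q N) (v2 • opB N) (u3 • opA q N) (v3 • opB N)
      (u23 • opA q N) (v23 • opB N) X₂' Y₂' φ₂')
    (R : ↥(CGsub N (u1 • opA q N) (v1 • opB N) (u2 • opA q N) (v2 • opB N)
      (u12 • opA q N) (v12 • opB N)) ⊗[ℂ]
      ↥(CGsub N (u12 • opA q N) (v12 • opB N) (u3 • opA q N) (v3 • opB N)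
      (u123 • opA q N) (v123 • opB N)) →ₗ[ℂ]
      ↥(CGsub N (u1 • opA q N) (v1 • opB N) (u23 • opA q N) (v23 • opB N)
      (u123 • opA q N) (v123 • opB N)) ⊗[ℂ]
      ↥(CGsub N (u2 • opA q N) (v2 • opB N) (u3 • opA q N) (v3 • opB N)
      (u23 • opA q N) (v23 • opB N)))
    (hR : psiL N (CGsub N (u1 • opA q N) (v1 • opB N) (u23 • opA q N) (v23 • opB N)
      (u123 • opA q N) (v123 • opB N))
      (CGsub N (u2 • opA q N) (v2 • opB N) (u3 • opA q N) (v3 • opB N)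
      (u23 • opA q N) (v23 • opB N)) ∘ₗ R =
      phiL N (CGsub N (u1 • opA q N) (v1 • opB N) (u2 • opA q N) (v2 • opB N)
      (u12 • opA q N) (v12 • opB N))
      (CGsub N (u12 • opA q N) (v12 • opB N) (u3 • opA q N) (v3 • opB N)
      (u123 • opA q N) (v123 • opB N)))
    (h : TensorProduct.map φ₁'.toLinearMap φ₂'.toLinearMap ∘ₗ L =
            c • (R ∘ₗ TensorProduct.map φ₁.toLinearMap φ₂.toLinearMap)) :
    StarC N q X₁ Y₁ X₂ Y₂ X₁' Y₁' X₂' Y₂' L := by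
  have n1 := pow_ne_zero N hu1
  have n2 := pow_ne_zero N hu2
  have ev' : v123 ^ N = (u12 ^ N)⁻¹ * v3 ^ N + v12 ^ N := by rw [ev123, ev12, eu12]; ring
  have ev'' : v123 ^ N = (u1 ^ N)⁻¹ * v23 ^ N + v1 ^ N := by
    rw [ev123, ev23, mul_inv]; ring
  have eu' : u123 ^ N = u12 ^ N * u3 ^ N := by rw [eu123, eu12]
  have eu'' : u123 ^ N = u1 ^ N * u23 ^ N := by rw [eu123, eu23, mul_assoc]
  obtain ⟨Ω1, Xh1, Yh1, hΩ1, hX1, hY1, W1, dH1, T1⟩ :=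
    CG_main hq hp hu1 hv1 hu2 hv2 hu12 hv12 eu12 ev12 _ rfl
  obtain ⟨Ω2, Xh2, Yh2, hΩ2, hX2, hY2, W2, dH2, T2⟩ :=
    CG_main hq hp hu12 hv12 hu3 hv3 hu123 hv123 eu' ev' _ rfl
  obtain ⟨Ω3, Xh3, Yh3, hΩ3, hX3, hY3, W3, dH3, T3⟩ :=
    CG_main hq hp hu1 hv1 hu23 hv23 hu123 hv123 eu'' ev'' _ rfl
  obtain ⟨Ω4, Xh4, Yh4, hΩ4, hX4, hY4, W4, dH4, T4⟩ :=
    CG_main hq hp hu2 hv2 hu3 hv3 hu23 hv23 eu23 ev23 _ rfl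
  obtain ⟨Re, hRe, hRu, TR⟩ := sixj_CG hq hp hu123 hv123 _ _ _ _ Ω1 Ω2 Ω3 Ω4 hΩ1 hΩ2 hΩ3 hΩ4
    W1 W2 W3 W4 (std_weyl hp hu1 hv1) (std_weyl hp hu2 hv2) (std_weyl hp hu3 hv3)
    (std_weyl hp hu12 hv12) (std_weyl hp hu23 hv23) T1 T2 T3 T4
  obtain rfl := hRu R hR
  obtain ⟨Le, hL, TLe⟩ := gen_fwd (L := L) φ₁ φ₂ φ₁' φ₂' hc
    (fun t => Subtype.ext (((i1 t).1).trans (hX1 _).symm))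
    (fun t => Subtype.ext (((i1 t).2).trans (hY1 _).symm))
    (fun t => Subtype.ext (((i2 t).1).trans (hX2 _).symm))
    (fun t => Subtype.ext (((i2 t).2).trans (hY2 _).symm))
    (fun t => Subtype.ext (((i3 t).1).trans (hX3 _).symm))
    (fun t => Subtype.ext (((i3 t).2).trans (hY3 _).symm))
    (fun t => Subtype.ext (((i4 t).1).trans (hX4 _).symm))
    (fun t => Subtype.ext (((i4 t).2).trans (hY4 _).symm))
    (fun t => LinearMap.congr_fun h t) TR
  exact ⟨Le, hL, TLe, φ₁.finrank_eq.trans dH1, φ₂.finrank_eq.trans dH2,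
    φ₁'.finrank_eq.trans dH3, φ₂'.finrank_eq.trans dH4⟩

set_option maxHeartbeats 2000000 in
theorem star_cond2 (hN : 1 ≤ N) (hq : q ≠ 0)
    (hqN : q ^ N = (-1 : ℂ) ^ (N + 1)) (hp : IsPrimitiveRoot (q ^ 2) N)
    (h₁ : IsWeylPair q X₁ Y₁) (h₂ : IsWeylPair q X₂ Y₂)
    (h₁' : IsWeylPair q X₁' Y₁') (h₂' : IsWeylPair q X₂' Y₂')
    (S : StarC N q X₁ Y₁ X₂ Y₂ X₁' Y₁' X₂' Y₂' L) :
    (∃ u1 v1 u2 v2 u3 v3 u12 v12 u23 v23 u123 v123 c : ℂ,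
      u1 ≠ 0 ∧ v1 ≠ 0 ∧ u2 ≠ 0 ∧ v2 ≠ 0 ∧ u3 ≠ 0 ∧ v3 ≠ 0 ∧
      u12 ≠ 0 ∧ v12 ≠ 0 ∧ u23 ≠ 0 ∧ v23 ≠ 0 ∧ u123 ≠ 0 ∧ v123 ≠ 0 ∧ c ≠ 0 ∧
      (u1 ^ N)⁻¹ * v2 ^ N + v1 ^ N ≠ 0 ∧
      (u2 ^ N)⁻¹ * v3 ^ N + v2 ^ N ≠ 0 ∧
      (u1 ^ N * u2 ^ N)⁻¹ * v3 ^ N + (u1 ^ N)⁻¹ * v2 ^ N + v1 ^ N ≠ 0 ∧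
      u12 ^ N = u1 ^ N * u2 ^ N ∧ v12 ^ N = (u1 ^ N)⁻¹ * v2 ^ N + v1 ^ N ∧
      u23 ^ N = u2 ^ N * u3 ^ N ∧ v23 ^ N = (u2 ^ N)⁻¹ * v3 ^ N + v2 ^ N ∧
      u123 ^ N = u1 ^ N * u2 ^ N * u3 ^ N ∧
      v123 ^ N = (u1 ^ N * u2 ^ N)⁻¹ * v3 ^ N + (u1 ^ N)⁻¹ * v2 ^ N + v1 ^ N ∧
      ∃ (φ₁ : V₁ ≃ₗ[ℂ] ↥(CGsub N (u1 • opA q N) (v1 • opB N) (u2 • opA q N)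
          (v2 • opB N) (u12 • opA q N) (v12 • opB N)))
        (φ₂ : V₂ ≃ₗ[ℂ] ↥(CGsub N (u12 • opA q N) (v12 • opB N) (u3 • opA q N)
          (v3 • opB N) (u123 • opA q N) (v123 • opB N)))
        (φ₁' : V₁' ≃ₗ[ℂ] ↥(CGsub N (u1 • opA q N) (v1 • opB N) (u23 • opA q N)
          (v23 • opB N) (u123 • opA q N) (v123 • opB N)))
        (φ₂' : V₂' ≃ₗ[ℂ] ↥(CGsub N (u2 • opA q N) (v2 • opB N) (u3 • opA q N)
          (v3 • opB N) (u23 • opA q N) (v23 • opB N))),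
        IntertwinesCG N q (u1 • opA q N) (v1 • opB N) (u2 • opA q N) (v2 • opB N)
          (u12 • opA q N) (v12 • opB N) X₁ Y₁ φ₁ ∧
        IntertwinesCG N q (u12 • opA q N) (v12 • opB N) (u3 • opA q N) (v3 • opB N)
          (u123 • opA q N) (v123 • opB N) X₂ Y₂ φ₂ ∧
        IntertwinesCG N q (u1 • opA q N) (v1 • opB N) (u23 • opA q N) (v23 • opB N)
          (u123 • opA q N) (v123 • opB N) X₁' Y₁' φ₁' ∧
        IntertwinesCG N q (u2 • opA q N) (v2 • opB N) (u3 • opA q N) (v3 • opB N)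
          (u23 • opA q N) (v23 • opB N) X₂' Y₂' φ₂' ∧
        ∃ R : ↥(CGsub N (u1 • opA q N) (v1 • opB N) (u2 • opA q N) (v2 • opB N)
              (u12 • opA q N) (v12 • opB N)) ⊗[ℂ]
            ↥(CGsub N (u12 • opA q N) (v12 • opB N) (u3 • opA q N) (v3 • opB N)
              (u123 • opA q N) (v123 • opB N)) →ₗ[ℂ]
            ↥(CGsub N (u1 • opA q N) (v1 • opB N) (u23 • opA q N) (v23 • opB N)
              (u123 • opA q N) (v123 • opB N)) ⊗[ℂ]
            ↥(CGsub N (u2 • opA q N) (v2 • opB N) (u3 • opA q N) (v3 • opB N)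
              (u23 • opA q N) (v23 • opB N)),
          -- R is Kashaev's 6j-symbol: Ψ ∘ R = Φ
          psiL N
            (CGsub N (u1 • opA q N) (v1 • opB N) (u23 • opA q N) (v23 • opB N)
              (u123 • opA q N) (v123 • opB N))
            (CGsub N (u2 • opA q N) (v2 • opB N) (u3 • opA q N) (v3 • opB N)
              (u23 • opA q N) (v23 • opB N)) ∘ₗ R = phiL N
            (CGsub N (u1 • opA q N) (v1 • opB N) (u2 • opA q N) (v2 • opB N)
              (u12 • opA q N) (v12 • opB N))
            (CGsub N (u12 • opA q N) (v12 • opB N) (u3 • opA q N) (v3 • opB N)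
              (u123 • opA q N) (v123 • opB N)) ∧
          TensorProduct.map φ₁'.toLinearMap φ₂'.toLinearMap ∘ₗ L =
            c • (R ∘ₗ TensorProduct.map φ₁.toLinearMap φ₂.toLinearMap)) := by
  obtain ⟨Le, hL, T, d1, d2, d3, d4⟩ := S
  have nt : Nontrivial (V₁' ⊗[ℂ] V₂') := Module.nontrivial_of_finrank_pos (R := ℂ) (by
    rw [Module.finrank_tensorProduct, d3, d4]; positivity)
  have nt2 : Nontrivial (CN N ⊗[ℂ] CN N) := Module.nontrivial_of_finrank_pos (R := ℂ) (by
    rw [Module.finrank_tensorProduct, finrank_CN]; positivity)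
  obtain ⟨s1, t1, hs1, ht1, e1, e2⟩ := weyl_scal hp d1 _ _ h₁
  obtain ⟨s2, t2, hs2, ht2, e3, e4⟩ := weyl_scal hp d2 _ _ h₂
  obtain ⟨s3, t3, hs3, ht3, e5, e6⟩ := weyl_scal hp d3 _ _ h₁'
  obtain ⟨s4, t4, hs4, ht4, e7, e8⟩ := weyl_scal hp d4 _ _ h₂'
  obtain ⟨-, -, -, p4⟩ := TL.scal hN hq hqN hp h₁ h₂ h₁' h₂' T e1 e2 e3 e4 e5 e6 e7 e8
  have na := pow_ne_zero N hs3
  have nb := pow_ne_zero N ht3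
  have nc := pow_ne_zero N hs4
  have nd := pow_ne_zero N ht4
  obtain ⟨x1, y1, x2, y2, x3, y3, kx1, ky1, kx2, ky2, kx3, ky3, k12, k23, k123, m1, m2, m3⟩ :=
    params na nb nc nd (by rw [← p4]; exact mul_ne_zero na (pow_ne_zero N ht2))
  obtain ⟨u1, hu1, rfl⟩ := nth_root N hN kx1
  obtain ⟨v1, hv1, rfl⟩ := nth_root N hN ky1
  obtain ⟨u2, hu2, rfl⟩ := nth_root N hN kx2
  obtain ⟨v2, hv2, rfl⟩ := nth_root N hN ky2
  obtain ⟨u3, hu3, rfl⟩ := nth_root N hN kx3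
  obtain ⟨v3, hv3, rfl⟩ := nth_root N hN ky3
  obtain ⟨u12, hu12, eu12⟩ := nth_root N hN (mul_ne_zero kx1 kx2)
  obtain ⟨u23, hu23, eu23⟩ := nth_root N hN (mul_ne_zero kx2 kx3)
  obtain ⟨u123, hu123, eu123⟩ := nth_root N hN (mul_ne_zero (mul_ne_zero kx1 kx2) kx3)
  obtain ⟨v12, hv12, ev12⟩ := nth_root N hN k12
  have k23' := inv_ne_zero nc
  rw [← k23] at k23'
  have k123' := inv_ne_zero (mul_ne_zero na nc)
  rw [← k123] at k123'
  obtain ⟨v23, hv23, ev23⟩ := nth_root N hN k23'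
  obtain ⟨v123, hv123, ev123⟩ := nth_root N hN k123'
  have n1 := pow_ne_zero N hu1
  have n2 := pow_ne_zero N hu2
  have ev' : v123 ^ N = (u12 ^ N)⁻¹ * v3 ^ N + v12 ^ N := by rw [ev123, ev12, eu12]; ring
  have ev'' : v123 ^ N = (u1 ^ N)⁻¹ * v23 ^ N + v1 ^ N := by
    rw [ev123, ev23, mul_inv]; ring
  have eu' : u123 ^ N = u12 ^ N * u3 ^ N := by rw [eu123, eu12]
  have eu'' : u123 ^ N = u1 ^ N * u23 ^ N := by rw [eu123, eu23, mul_assoc]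
  obtain ⟨Ω1, Xh1, Yh1, hΩ1, hX1, hY1, W1, dH1, T1⟩ :=
    CG_main hq hp hu1 hv1 hu2 hv2 hu12 hv12 eu12 ev12 _ rfl
  obtain ⟨Ω2, Xh2, Yh2, hΩ2, hX2, hY2, W2, dH2, T2⟩ :=
    CG_main hq hp hu12 hv12 hu3 hv3 hu123 hv123 eu' ev' _ rfl
  obtain ⟨Ω3, Xh3, Yh3, hΩ3, hX3, hY3, W3, dH3, T3⟩ :=
    CG_main hq hp hu1 hv1 hu23 hv23 hu123 hv123 eu'' ev'' _ rfl
  obtain ⟨Ω4, Xh4, Yh4, hΩ4, hX4, hY4, W4, dH4, T4⟩ :=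
    CG_main hq hp hu2 hv2 hu3 hv3 hu23 hv23 eu23 ev23 _ rfl
  obtain ⟨Re, hRe, hRu, TR⟩ := sixj_CG hq hp hu123 hv123 _ _ _ _ Ω1 Ω2 Ω3 Ω4 hΩ1 hΩ2 hΩ3 hΩ4
    W1 W2 W3 W4 (std_weyl hp hu1 hv1) (std_weyl hp hu2 hv2) (std_weyl hp hu3 hv3)
    (std_weyl hp hu12 hv12) (std_weyl hp hu23 hv23) T1 T2 T3 T4
  -- scalars of the target spaces
  obtain ⟨a3, b3, ha3, hb3, g1, g2⟩ := weyl_scal hp dH3 _ _ W3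
  obtain ⟨a4, b4, ha4, hb4, g3, g4⟩ := weyl_scal hp dH4 _ _ W4
  obtain ⟨-, r2, r3, -⟩ := TL.scal hN hq hqN hp W3 (std_weyl hp hu123 hv123) (std_weyl hp hu1 hv1)
    (std_weyl hp hu23 hv23) T3 g1 g2 (stdA_N hp _) (stdB_N _) (stdA_N hp _) (stdB_N _)
    (stdA_N hp _) (stdB_N _)
  obtain ⟨-, r2', r3', -⟩ := TL.scal hN hq hqN hp W4 (std_weyl hp hu23 hv23) (std_weyl hp hu2 hv2)
    (std_weyl hp hu3 hv3) T4 g3 g4 (stdA_N hp _) (stdB_N _) (stdA_N hp _) (stdB_N _)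
    (stdA_N hp _) (stdB_N _)
  have z23 : v23 ^ N = (s4 ^ N)⁻¹ := ev23.trans k23
  have z123 : v123 ^ N = (s3 ^ N * s4 ^ N)⁻¹ := ev123.trans k123
  have q1 : a3 ^ N = s3 ^ N := by
    rw [z23, z123] at r2
    field_simp at r2
    exact r2
  have q3 : a4 ^ N = s4 ^ N := by
    rw [z23, m3] at r2'
    field_simp at r2'
    exact r2'
  have q2 : b3 ^ N = t3 ^ N := by
    rw [q1, eu123, z123] at r3
    field_simp at r3
    apply mul_right_cancel₀ (mul_ne_zero kx2 kx3)
    rw [← m1]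
    linear_combination -r3
  have q4 : b4 ^ N = t4 ^ N := by
    rw [q3, eu23, z23, m2] at r3'
    field_simp at r3'
    linear_combination -r3'
  rw [q1] at g1
  rw [q2] at g2
  rw [q3] at g3
  rw [q4] at g4
  obtain ⟨f1, hf1, hf1'⟩ := weyl_iso hp d3 dH3 h₁' W3 hs3 ht3 e5 e6 g1 g2
  obtain ⟨f2, hf2, hf2'⟩ := weyl_iso hp d4 dH4 h₂' W4 hs4 ht4 e7 e8 g3 g4
  obtain ⟨l1, l2, a1, a2, a3, a4, a5⟩ := gen_bwd hN hq hqN hp Le Re h₁ h₂ h₁' h₂' W1 W2 W3 W4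
    d1 d2 d3 d4 dH1 dH2 f1 f2 hf1 hf1' hf2 hf2' T TR
  refine ⟨u1, v1, u2, v2, u3, v3, u12, v12, u23, v23, u123, v123, 1, hu1, hv1, hu2, hv2, hu3, hv3,
    hu12, hv12, hu23, hv23, hu123, hv123, one_ne_zero, k12, k23', k123', eu12, ev12, eu23, ev23,
    eu123, ev123, l1, l2, f1, f2, fun w => ⟨?_, ?_⟩, fun w => ⟨?_, ?_⟩, fun w => ⟨?_, ?_⟩,
    fun w => ⟨?_, ?_⟩, Re.toLinearMap, hRe, ?_⟩
  · rw [a1, hX1]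
  · rw [a2, hY1]
  · rw [a3, hX2]
  · rw [a4, hY2]
  · rw [hf1, hX3]
  · rw [hf1', hY3]
  · rw [hf2, hX4]
  · rw [hf2', hY4]
  · rw [one_smul]
    apply LinearMap.ext; intro t
    rw [LinearMap.comp_apply, ← hL, a5]; rfl

end main2

/-- equivalence of the canonical-map normal form (1) and the
6j-symbol normal form (2) for a linear map L : V₁ ⊗ V₂ → V₁′ ⊗ V₂′ between
tensor products of spaces carrying Weyl pairs. -/
theorem stmt19 (N : ℕ) (hN : 1 ≤ N) (q : ℂ)
    (hqN : q ^ N = (-1 : ℂ) ^ (N + 1)) (hq : IsPrimitiveRoot (q ^ 2) N)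
    (V₁ V₂ V₁' V₂' : Type*)
    [AddCommGroup V₁] [Module ℂ V₁] [FiniteDimensional ℂ V₁]
    [AddCommGroup V₂] [Module ℂ V₂] [FiniteDimensional ℂ V₂]
    [AddCommGroup V₁'] [Module ℂ V₁'] [FiniteDimensional ℂ V₁']
    [AddCommGroup V₂'] [Module ℂ V₂'] [FiniteDimensional ℂ V₂']
    (X₁ Y₁ : Module.End ℂ V₁) (h₁ : IsWeylPair q X₁ Y₁)
    (X₂ Y₂ : Module.End ℂ V₂) (h₂ : IsWeylPair q X₂ Y₂)
    (X₁' Y₁' : Module.End ℂ V₁') (h₁' : IsWeylPair q X₁' Y₁')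
    (X₂' Y₂' : Module.End ℂ V₂') (h₂' : IsWeylPair q X₂' Y₂')
    (L : V₁ ⊗[ℂ] V₂ →ₗ[ℂ] V₁' ⊗[ℂ] V₂') :
    -- (1) L is, up to isomorphisms and a scalar, the canonical map Ω(μ,ν)
    (∃ u v u' v' u'' v'' c : ℂ,
      u ≠ 0 ∧ v ≠ 0 ∧ u' ≠ 0 ∧ v' ≠ 0 ∧ u'' ≠ 0 ∧ v'' ≠ 0 ∧ c ≠ 0 ∧
      (u ^ N)⁻¹ * v' ^ N + v ^ N ≠ 0 ∧
      u'' ^ N = u ^ N * u' ^ N ∧ v'' ^ N = (u ^ N)⁻¹ * v' ^ N + v ^ N ∧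
      ∃ (φ₁ : V₁ ≃ₗ[ℂ] ↥(CGsub N (u • opA q N) (v • opB N) (u' • opA q N)
          (v' • opB N) (u'' • opA q N) (v'' • opB N)))
        (φ₂ : V₂ ≃ₗ[ℂ] CN N) (φ₁' : V₁' ≃ₗ[ℂ] CN N) (φ₂' : V₂' ≃ₗ[ℂ] CN N),
        IntertwinesCG N q (u • opA q N) (v • opB N) (u' • opA q N) (v' • opB N)
          (u'' • opA q N) (v'' • opB N) X₁ Y₁ φ₁ ∧
        IntertwinesStd N (u'' • opA q N) (v'' • opB N) X₂ Y₂ φ₂ ∧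
        IntertwinesStd N (u • opA q N) (v • opB N) X₁' Y₁' φ₁' ∧
        IntertwinesStd N (u' • opA q N) (v' • opB N) X₂' Y₂' φ₂' ∧
        TensorProduct.map φ₁'.toLinearMap φ₂'.toLinearMap ∘ₗ L =
          c • (TensorProduct.lift (CGsub N (u • opA q N) (v • opB N) (u' • opA q N)
              (v' • opB N) (u'' • opA q N) (v'' • opB N)).subtype ∘ₗ
            TensorProduct.map φ₁.toLinearMap φ₂.toLinearMap))
    ↔
    -- (2) L is, up to isomorphisms and a scalar, Kashaev's 6j-symbol R(μ,ν,σ)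
    (∃ u1 v1 u2 v2 u3 v3 u12 v12 u23 v23 u123 v123 c : ℂ,
      u1 ≠ 0 ∧ v1 ≠ 0 ∧ u2 ≠ 0 ∧ v2 ≠ 0 ∧ u3 ≠ 0 ∧ v3 ≠ 0 ∧
      u12 ≠ 0 ∧ v12 ≠ 0 ∧ u23 ≠ 0 ∧ v23 ≠ 0 ∧ u123 ≠ 0 ∧ v123 ≠ 0 ∧ c ≠ 0 ∧
      (u1 ^ N)⁻¹ * v2 ^ N + v1 ^ N ≠ 0 ∧
      (u2 ^ N)⁻¹ * v3 ^ N + v2 ^ N ≠ 0 ∧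
      (u1 ^ N * u2 ^ N)⁻¹ * v3 ^ N + (u1 ^ N)⁻¹ * v2 ^ N + v1 ^ N ≠ 0 ∧
      u12 ^ N = u1 ^ N * u2 ^ N ∧ v12 ^ N = (u1 ^ N)⁻¹ * v2 ^ N + v1 ^ N ∧
      u23 ^ N = u2 ^ N * u3 ^ N ∧ v23 ^ N = (u2 ^ N)⁻¹ * v3 ^ N + v2 ^ N ∧
      u123 ^ N = u1 ^ N * u2 ^ N * u3 ^ N ∧
      v123 ^ N = (u1 ^ N * u2 ^ N)⁻¹ * v3 ^ N + (u1 ^ N)⁻¹ * v2 ^ N + v1 ^ N ∧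
      ∃ (φ₁ : V₁ ≃ₗ[ℂ] ↥(CGsub N (u1 • opA q N) (v1 • opB N) (u2 • opA q N)
          (v2 • opB N) (u12 • opA q N) (v12 • opB N)))
        (φ₂ : V₂ ≃ₗ[ℂ] ↥(CGsub N (u12 • opA q N) (v12 • opB N) (u3 • opA q N)
          (v3 • opB N) (u123 • opA q N) (v123 • opB N)))
        (φ₁' : V₁' ≃ₗ[ℂ] ↥(CGsub N (u1 • opA q N) (v1 • opB N) (u23 • opA q N)
          (v23 • opB N) (u123 • opA q N) (v123 • opB N)))
        (φ₂' : V₂' ≃ₗ[ℂ] ↥(CGsub N (u2 • opA q N) (v2 • opB N) (u3 • opA q N)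
          (v3 • opB N) (u23 • opA q N) (v23 • opB N))),
        IntertwinesCG N q (u1 • opA q N) (v1 • opB N) (u2 • opA q N) (v2 • opB N)
          (u12 • opA q N) (v12 • opB N) X₁ Y₁ φ₁ ∧
        IntertwinesCG N q (u12 • opA q N) (v12 • opB N) (u3 • opA q N) (v3 • opB N)
          (u123 • opA q N) (v123 • opB N) X₂ Y₂ φ₂ ∧
        IntertwinesCG N q (u1 • opA q N) (v1 • opB N) (u23 • opA q N) (v23 • opB N)
          (u123 • opA q N) (v123 • opB N) X₁' Y₁' φ₁' ∧
        IntertwinesCG N q (u2 • opA q N) (v2 • opB N) (u3 • opA q N) (v3 • opB N)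
          (u23 • opA q N) (v23 • opB N) X₂' Y₂' φ₂' ∧
        ∃ R : ↥(CGsub N (u1 • opA q N) (v1 • opB N) (u2 • opA q N) (v2 • opB N)
              (u12 • opA q N) (v12 • opB N)) ⊗[ℂ]
            ↥(CGsub N (u12 • opA q N) (v12 • opB N) (u3 • opA q N) (v3 • opB N)
              (u123 • opA q N) (v123 • opB N)) →ₗ[ℂ]
            ↥(CGsub N (u1 • opA q N) (v1 • opB N) (u23 • opA q N) (v23 • opB N)
              (u123 • opA q N) (v123 • opB N)) ⊗[ℂ]
            ↥(CGsub N (u2 • opA q N) (v2 • opB N) (u3 • opA q N) (v3 • opB N)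
              (u23 • opA q N) (v23 • opB N)),
          -- R is Kashaev's 6j-symbol: Ψ ∘ R = Φ
          psiL N
            (CGsub N (u1 • opA q N) (v1 • opB N) (u23 • opA q N) (v23 • opB N)
              (u123 • opA q N) (v123 • opB N))
            (CGsub N (u2 • opA q N) (v2 • opB N) (u3 • opA q N) (v3 • opB N)
              (u23 • opA q N) (v23 • opB N)) ∘ₗ R = phiL N
            (CGsub N (u1 • opA q N) (v1 • opB N) (u2 • opA q N) (v2 • opB N)
              (u12 • opA q N) (v12 • opB N))
            (CGsub N (u12 • opA q N) (v12 • opB N) (u3 • opA q N) (v3 • opB N)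
              (u123 • opA q N) (v123 • opB N)) ∧
          TensorProduct.map φ₁'.toLinearMap φ₂'.toLinearMap ∘ₗ L =
            c • (R ∘ₗ TensorProduct.map φ₁.toLinearMap φ₂.toLinearMap)) := by
  have hne : NeZero N := ⟨by omega⟩
  have hq0 : q ≠ 0 := by
    rintro rfl
    exact hq.ne_zero (by omega) (by norm_num)
  constructor
  · rintro ⟨u, v, u', v', u'', v'', c, hu, hv, hu', hv', hu'', hv'', hc, -, eu, ev, φ₁, φ₂, φ₁', φ₂',
      i1, i2, i3, i4, h⟩
    exact star_cond2 hN hq0 hqN hq h₁ h₂ h₁' h₂'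
      (cond1_star hq0 hq hu hv hu' hv' hu'' hv'' hc eu ev φ₁ φ₂ φ₁' φ₂' i1 i2 i3 i4 h)
  · rintro ⟨u1, v1, u2, v2, u3, v3, u12, v12, u23, v23, u123, v123, c, hu1, hv1, hu2, hv2, hu3, hv3,
      hu12, hv12, hu23, hv23, hu123, hv123, hc, -, -, -, eu12, ev12, eu23, ev23, eu123, ev123,
      φ₁, φ₂, φ₁', φ₂', i1, i2, i3, i4, R, hR, h⟩
    exact star_cond1 hN hq0 hqN hq h₁ h₂ h₁' h₂'
      (cond2_star hq0 hq hu1 hv1 hu2 hv2 hu3 hv3 hu12 hv12 hu23 hv23 hu123 hv123 hc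
        eu12 ev12 eu23 ev23 eu123 ev123 φ₁ φ₂ φ₁' φ₂' i1 i2 i3 i4 R hR h)

end
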